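/- arXiv:2409.06200 — 2 statements merged into one kernel-verified Lean document; each statement's English description precedes it below -/
import Mathlib

section
/- Let 𝒞 be an extension-closed pseudo-variety of finite groups and let A and B be groups with A nontrivial. Then the restricted wreath product A ≀ B is 𝒞-hereditarily conjugacy separable if and only if at least one of the following holds: (i) A is 𝒞-hereditarily conjugacy separable and B ∈ 𝒞; or (ii) A is abelian and residually-𝒞, and B is 𝒞-hereditarily conjugacy separable and every cyclic subgroup of B is 𝒞-separable in B. -/
open Pointwise

universe u

structure ECPseudoVariety : Type (u + 1) where
  mem : ∀ (G : Type u) [Group G], Prop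
  finite : ∀ (G : Type u) [Group G], mem G → Finite G
  iso_closed : ∀ (G H : Type u) [Group G] [Group H], G ≃* H → mem G → mem H
  subgroup_closed : ∀ (G : Type u) [Group G] (H : Subgroup G), mem G → mem ↥H
  quotient_closed : ∀ (G : Type u) [Group G] (N : Subgroup G) [N.Normal],
    mem G → mem (G ⧸ N)
  prod_closed : ∀ (G H : Type u) [Group G] [Group H], mem G → mem H → mem (G × H)
  extension_closed : ∀ (G : Type u) [Group G] (N : Subgroup G) [N.Normal],
    mem ↥N → mem (G ⧸ N) → mem G

namespace ECPseudoVariety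

variable (V : ECPseudoVariety.{u})

def coC (G : Type u) [Group G] : Set (Subgroup G) :=
  {N | ∃ hN : N.Normal, haveI := hN; V.mem (G ⧸ N)}

def CSeparable {G : Type u} [Group G] (X : Set G) : Prop :=
  ∀ g : G, g ∉ X → ∃ N ∈ V.coC G, (QuotientGroup.mk g : G ⧸ N) ∉ QuotientGroup.mk '' X

def Residually (G : Type u) [Group G] : Prop :=
  ∀ g : G, g ≠ 1 → ∃ N ∈ V.coC G, g ∉ N

def ConjSep (G : Type u) [Group G] : Prop :=
  ∀ g : G, V.CSeparable {x : G | IsConj g x}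

def COpen {G : Type u} [Group G] (H : Subgroup G) : Prop :=
  ∃ N ∈ V.coC G, N ≤ H

def HCS (G : Type u) [Group G] : Prop :=
  V.ConjSep G ∧ ∀ H : Subgroup G, V.COpen H → V.ConjSep ↥H

def CyclicSep (G : Type u) [Group G] : Prop :=
  ∀ g : G, V.CSeparable ((Subgroup.zpowers g : Subgroup G) : Set G)

end ECPseudoVariety

def CCWitness {G : Type u} [Group G] (g : G) (K L : Subgroup G) [L.Normal] : Prop :=
  (Subgroup.centralizer {(QuotientGroup.mk g : G ⧸ L)} : Set (G ⧸ L)) ⊆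
    QuotientGroup.mk '' ((Subgroup.centralizer {g} : Set G) * (K : Set G))

namespace ECPseudoVariety

variable (V : ECPseudoVariety.{u})

def SatisfiesCCAt {G : Type u} [Group G] (g : G) : Prop :=
  ∀ K ∈ V.coC G, ∃ L ∈ V.coC G, L ≤ K ∧ ∃ hL : L.Normal, haveI := hL; CCWitness g K L

def SatisfiesCC (G : Type u) [Group G] : Prop :=
  ∀ g : G, V.SatisfiesCCAt g

end ECPseudoVariety

/-- `G` is conjugacy separable. -/
def IsConjSeparable (G : Type u) [Group G] : Prop :=
  ∀ x y : G, ¬ IsConj x y → ∃ N : Subgroup G, ∃ hN : N.Normal, N.FiniteIndex ∧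
    (haveI := hN; ¬ IsConj (QuotientGroup.mk x : G ⧸ N) (QuotientGroup.mk y))

/-- `G` is hereditarily conjugacy separable: every finite-index subgroup is
conjugacy separable. -/
def IsHereditarilyConjSeparable (G : Type u) [Group G] : Prop :=
  ∀ H : Subgroup G, H.FiniteIndex → IsConjSeparable H

/-- `G` is residually finite. -/
def IsResiduallyFinite (G : Type u) [Group G] : Prop :=
  ∀ g : G, g ≠ 1 → ∃ N : Subgroup G, N.Normal ∧ N.FiniteIndex ∧ g ∉ N

/-- Normal subgroups with finite `p`-group quotient. -/
def pCoC (p : ℕ) (G : Type u) [Group G] : Set (Subgroup G) :=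
  {N | ∃ hN : N.Normal, Finite (G ⧸ N) ∧ (haveI := hN; IsPGroup p (G ⧸ N))}

/-- `G` is `p`-conjugacy separable. -/
def pConjSep (p : ℕ) (G : Type u) [Group G] : Prop :=
  ∀ x y : G, ¬ IsConj x y → ∃ N ∈ pCoC p G, ∃ hN : N.Normal,
    haveI := hN; ¬ IsConj (QuotientGroup.mk x : G ⧸ N) (QuotientGroup.mk y)

/-- A subgroup is `p`-open if it contains a normal subgroup with finite
`p`-group quotient. -/
def pOpen (p : ℕ) {G : Type u} [Group G] (H : Subgroup G) : Prop :=
  ∃ N ∈ pCoC p G, N ≤ H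

/-- `G` is `p`-hereditarily conjugacy separable. -/
def pHCS (p : ℕ) (G : Type u) [Group G] : Prop :=
  pConjSep p G ∧ ∀ H : Subgroup G, pOpen p H → pConjSep p H

/-- The base group of the restricted wreath product: finitely supported functions `B → A`. -/
def WreathBase (A B : Type u) [Group A] : Subgroup (B → A) where
  carrier := {f | (Function.mulSupport f).Finite}
  one_mem' := by simp
  mul_mem' := fun hf hg =>
    Set.Finite.subset (Set.Finite.union hf hg) (Function.mulSupport_mul _ _)
  inv_mem' := fun hf => Set.Finite.subset hf fun x hx => by
    simp only [Function.mem_mulSupport] at hx ⊢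
    simpa using hx

/-- Shift automorphism of the base group: `(c • f) x = f (c⁻¹ * x)`. -/
def wreathShift (A B : Type u) [Group A] [Group B] (c : B) :
    WreathBase A B ≃* WreathBase A B where
  toFun f := ⟨fun x => (f : B → A) (c⁻¹ * x), by
    have hsub : (Function.mulSupport fun x => (f : B → A) (c⁻¹ * x)) ⊆
        (fun x : B => c * x) '' Function.mulSupport (f : B → A) := by
      intro x hx
      exact ⟨c⁻¹ * x, hx, by simp⟩
    exact (f.2.image _).subset hsub⟩
  invFun f := ⟨fun x => (f : B → A) (c * x), by
    have hsub : (Function.mulSupport fun x => (f : B → A) (c * x)) ⊆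
        (fun x : B => c⁻¹ * x) '' Function.mulSupport (f : B → A) := by
      intro x hx
      exact ⟨c * x, hx, by simp⟩
    exact (f.2.image _).subset hsub⟩
  left_inv f := Subtype.ext (funext fun x => by simp)
  right_inv f := Subtype.ext (funext fun x => by simp)
  map_mul' f g := rfl

/-- The action of `B` on the base group of the wreath product. -/
def wreathAction (A B : Type u) [Group A] [Group B] : B →* MulAut (WreathBase A B) where
  toFun := wreathShift A B
  map_one' := by
    apply MulEquiv.ext
    intro f
    apply Subtype.ext
    funext x
    show (f : B → A) ((1 : B)⁻¹ * x) = (f : B → A) x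
    simp
  map_mul' c d := by
    apply MulEquiv.ext
    intro f
    apply Subtype.ext
    funext x
    show (f : B → A) ((c * d)⁻¹ * x) = (f : B → A) (d⁻¹ * (c⁻¹ * x))
    rw [mul_inv_rev, mul_assoc]

/-- The restricted wreath product `A ≀ B`. -/
abbrev RWreath (A B : Type u) [Group A] [Group B] : Type u :=
  SemidirectProduct (WreathBase A B) B (wreathAction A B)
def rcoset {B : Type u} [Group B] (b x : B) : Set B :=
  {y : B | y * x⁻¹ ∈ Subgroup.zpowers b}

lemma rcoset_mul_left {B : Type u} [Group B] {b c : B}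
    (hc : c ∈ Subgroup.centralizer {b}) (y : B) :
    rcoset b (c * y) = (c * ·) '' rcoset b y := by
  have hcomm : b * c = c * b := Subgroup.mem_centralizer_iff.mp hc b rfl
  have hC : Commute b c := hcomm
  ext z
  simp only [rcoset, Set.mem_setOf_eq, Set.mem_image]
  constructor
  · intro hz
    refine ⟨c⁻¹ * z, ?_, by group⟩
    obtain ⟨k, hk⟩ := Subgroup.mem_zpowers_iff.mp hz
    refine Subgroup.mem_zpowers_iff.mpr ⟨k, ?_⟩
    have hcc : b ^ k * c = c * b ^ k := (hC.zpow_left k).eq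
    have hk' : z * y⁻¹ = b ^ k * c := by
      rw [hk]; group
    calc b ^ k = c⁻¹ * (c * b ^ k) := by group
      _ = c⁻¹ * (b ^ k * c) := by rw [hcc]
      _ = c⁻¹ * (z * y⁻¹) := by rw [hk']
      _ = c⁻¹ * z * y⁻¹ := by group
  · rintro ⟨w, hw, rfl⟩
    obtain ⟨k, hk⟩ := Subgroup.mem_zpowers_iff.mp hw
    refine Subgroup.mem_zpowers_iff.mpr ⟨k, ?_⟩
    have hcc : b ^ k * c = c * b ^ k := (hC.zpow_left k).eq
    calc b ^ k = c * b ^ k * c⁻¹ := by rw [← hcc]; group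
      _ = c * (w * y⁻¹) * c⁻¹ := by rw [hk]
      _ = c * w * (c * y)⁻¹ := by group

/-- An element `fb` of `A ≀ B` is reduced if distinct elements of `supp f` lie in
distinct right cosets of `⟨b⟩`. -/
def IsReducedPair {A B : Type u} [Group A] [Group B] (f : WreathBase A B) (b : B) : Prop :=
  ∀ s ∈ Function.mulSupport (f : B → A), ∀ t ∈ Function.mulSupport (f : B → A),
    t * s⁻¹ ∈ Subgroup.zpowers b → s = t

/-- The set `C_B(f,b) = C⁺_B(f,b) ∩ C_B(b)`. -/
def CBset {A B : Type u} [Group A] [Group B] (f : WreathBase A B) (b : B) : Set B :=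
  {c | c ∈ Subgroup.centralizer {b} ∧
    ∀ a : A, a ≠ 1 → a ∈ Set.range (f : B → A) →
      (fun s : B => rcoset b (c * s)) '' ((f : B → A) ⁻¹' {a}) =
        rcoset b '' ((f : B → A) ⁻¹' {a})}

/-- `C_B(f,b)` as a subgroup of `B`. -/
def CBsubgroup {A B : Type u} [Group A] [Group B] (f : WreathBase A B) (b : B) :
    Subgroup B where
  carrier := CBset f b
  one_mem' := by
    refine ⟨Subgroup.one_mem _, ?_⟩
    intro a _ _
    simp
  mul_mem' := by
    rintro c c' ⟨hc1, hc2⟩ ⟨hc'1, hc'2⟩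
    refine ⟨Subgroup.mul_mem _ hc1 hc'1, ?_⟩
    intro a ha har
    calc (fun s : B => rcoset b (c * c' * s)) '' ((f : B → A) ⁻¹' {a})
        = (fun s : B => (c * ·) '' rcoset b (c' * s)) '' ((f : B → A) ⁻¹' {a}) := by
          have he : (fun s : B => rcoset b (c * c' * s)) =
              fun s : B => (c * ·) '' rcoset b (c' * s) := by
            funext s; rw [mul_assoc, rcoset_mul_left hc1]
          rw [he]
      _ = (fun X : Set B => (c * ·) '' X) ''
            ((fun s : B => rcoset b (c' * s)) '' ((f : B → A) ⁻¹' {a})) := by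
          rw [Set.image_image]
      _ = (fun X : Set B => (c * ·) '' X) '' (rcoset b '' ((f : B → A) ⁻¹' {a})) := by
          rw [hc'2 a ha har]
      _ = (fun s : B => (c * ·) '' rcoset b s) '' ((f : B → A) ⁻¹' {a}) := by
          rw [Set.image_image]
      _ = (fun s : B => rcoset b (c * s)) '' ((f : B → A) ⁻¹' {a}) := by
          have he : (fun s : B => (c * ·) '' rcoset b s) =
              fun s : B => rcoset b (c * s) := by
            funext s; rw [rcoset_mul_left hc1]
          rw [he]
      _ = rcoset b '' ((f : B → A) ⁻¹' {a}) := hc2 a ha har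
  inv_mem' := by
    rintro c ⟨hc1, hc2⟩
    have hinv : c⁻¹ ∈ Subgroup.centralizer {b} := Subgroup.inv_mem _ hc1
    refine ⟨hinv, ?_⟩
    intro a ha har
    calc (fun s : B => rcoset b (c⁻¹ * s)) '' ((f : B → A) ⁻¹' {a})
        = (fun s : B => (c⁻¹ * ·) '' rcoset b s) '' ((f : B → A) ⁻¹' {a}) := by
          have he : (fun s : B => rcoset b (c⁻¹ * s)) =
              fun s : B => (c⁻¹ * ·) '' rcoset b s := by
            funext s; rw [rcoset_mul_left hinv]
          rw [he]
      _ = (fun X : Set B => (c⁻¹ * ·) '' X) '' (rcoset b '' ((f : B → A) ⁻¹' {a})) := by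
          rw [Set.image_image]
      _ = (fun X : Set B => (c⁻¹ * ·) '' X) ''
            ((fun s : B => rcoset b (c * s)) '' ((f : B → A) ⁻¹' {a})) := by
          rw [hc2 a ha har]
      _ = (fun s : B => (c⁻¹ * ·) '' rcoset b (c * s)) '' ((f : B → A) ⁻¹' {a}) := by
          rw [Set.image_image]
      _ = rcoset b '' ((f : B → A) ⁻¹' {a}) := by
          have he : (fun s : B => (c⁻¹ * ·) '' rcoset b (c * s)) =
              fun s : B => rcoset b s := by
            funext s; rw [← rcoset_mul_left hinv, inv_mul_cancel_left]
          rw [he]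

/-- The permutation group condition set `Σ(f,b)`. -/
def SigmaSet {A B : Type u} [Group A] [Group B] (f : WreathBase A B) (b : B) :
    Set (Equiv.Perm ↥(Function.mulSupport (f : B → A))) :=
  {σ | ∀ a : A, a ≠ 1 →
    (fun s : ↥(Function.mulSupport (f : B → A)) => rcoset b ↑(σ s)) ''
        {s : ↥(Function.mulSupport (f : B → A)) | (f : B → A) ↑s = a} =
      (fun s : ↥(Function.mulSupport (f : B → A)) => rcoset b ↑s) ''
        {s : ↥(Function.mulSupport (f : B → A)) | (f : B → A) ↑s = a}}

namespace ECPseudoVariety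
section basics
variable {V : ECPseudoVariety.{u}}

lemma mem_of_inj {G H : Type u} [Group G] [Group H] (φ : G →* H)
    (hφ : Function.Injective φ) (h : V.mem H) : V.mem G :=
  V.iso_closed _ _ (MonoidHom.ofInjective hφ).symm (V.subgroup_closed _ φ.range h)

lemma coC_of_hom {G Q : Type u} [Group G] [Group Q] (φ : G →* Q) (hQ : V.mem Q)
    {K : Subgroup G} (h : ∀ g, g ∈ K ↔ φ g = 1) : K ∈ V.coC G := by
  have : K = φ.ker := by ext g; rw [h, MonoidHom.mem_ker]
  subst this
  exact ⟨inferInstance, mem_of_inj (QuotientGroup.kerLift φ) (QuotientGroup.kerLift_injective φ) hQ⟩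

lemma normal_of_coC {G : Type u} [Group G] {N : Subgroup G} (h : N ∈ V.coC G) : N.Normal := h.1

lemma coC_comap {G H : Type u} [Group G] [Group H] (φ : G →* H) {N : Subgroup H}
    (h : N ∈ V.coC H) : N.comap φ ∈ V.coC G := by
  obtain ⟨hN, hm⟩ := h
  refine coC_of_hom ((QuotientGroup.mk' N).comp φ) hm ?_
  intro g
  simp

lemma coC_inf {G : Type u} [Group G] {N M : Subgroup G} (h : N ∈ V.coC G) (h' : M ∈ V.coC G) :
    N ⊓ M ∈ V.coC G := by
  obtain ⟨hN, hm⟩ := h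
  obtain ⟨hN', hm'⟩ := h'
  refine coC_of_hom ((QuotientGroup.mk' N).prod (QuotientGroup.mk' M)) (V.prod_closed _ _ hm hm') ?_
  intro g
  simp [Subgroup.mem_inf, Prod.ext_iff]

lemma mem_of_bot {G : Type u} [Group G] (h : (⊥ : Subgroup G) ∈ V.coC G) : V.mem G := by
  obtain ⟨_, h⟩ := h
  exact V.iso_closed _ _ QuotientGroup.quotientBot h

lemma bot_of_mem {G : Type u} [Group G] (h : V.mem G) : (⊥ : Subgroup G) ∈ V.coC G :=
  coC_of_hom (MonoidHom.id G) h (by simp)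

/-- nonemptiness -/
def NE (V : ECPseudoVariety.{u}) : Prop := ∃ (Q : Type u) (_ : Group Q), V.mem Q

lemma top_coC (hV : V.NE) (G : Type u) [Group G] : (⊤ : Subgroup G) ∈ V.coC G := by
  obtain ⟨Q, _, hQ⟩ := hV
  exact coC_of_hom (1 : G →* Q) hQ (by simp)

lemma NE_of_coC {G : Type u} [Group G] {N : Subgroup G} (h : N ∈ V.coC G) : V.NE := by
  obtain ⟨_, h⟩ := h
  exact ⟨_, _, h⟩

lemma avoid {G : Type u} [Group G] {ι : Type*} (F : Set ι) (hF : F.Finite)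
    (P : ι → Subgroup G → Prop) (mono : ∀ i N N', N' ≤ N → P i N → P i N')
    (h : ∀ i ∈ F, ∃ N ∈ V.coC G, P i N) {M : Subgroup G} (hM : M ∈ V.coC G) :
    ∃ N ∈ V.coC G, N ≤ M ∧ ∀ i ∈ F, P i N := by
  induction F, hF using Set.Finite.induction_on with
  | empty => exact ⟨M, hM, le_rfl, by simp⟩
  | @insert a s ha hs ih =>
    obtain ⟨N, hN, hNM, hP⟩ := ih (fun i hi => h i (Set.mem_insert_of_mem _ hi))
    obtain ⟨N', hN', hP'⟩ := h a (Set.mem_insert _ _)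
    refine ⟨N ⊓ N', coC_inf hN hN', inf_le_left.trans hNM, ?_⟩
    rintro i (rfl | hi)
    · exact mono _ _ _ inf_le_right hP'
    · exact mono _ _ _ inf_le_left (hP i hi)

lemma csep_iff {G : Type u} [Group G] {X : Set G} :
    V.CSeparable X ↔ ∀ g, g ∉ X → ∃ N ∈ V.coC G, ∀ x ∈ X, x⁻¹ * g ∉ N := by
  unfold CSeparable
  simp only [Set.mem_image, not_exists, not_and, QuotientGroup.eq]

lemma coC_ext {G : Type u} [Group G] {K N : Subgroup G} (hK : K ∈ V.coC G) (hNn : N.Normal)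
    (hNK : N ≤ K) (h : N.subgroupOf K ∈ V.coC K) : N ∈ V.coC G := by
  obtain ⟨hKn, hKm⟩ := hK
  obtain ⟨hn, hm⟩ := h
  refine ⟨hNn, ?_⟩
  let φ : K →* G ⧸ N := (QuotientGroup.mk' N).comp K.subtype
  have hker : φ.ker = N.subgroupOf K := by
    ext x; simp [φ, Subgroup.mem_subgroupOf]
  have hrange : φ.range = K.map (QuotientGroup.mk' N) := by
    rw [MonoidHom.range_comp, Subgroup.range_subtype]
  have h1 : V.mem φ.range := by
    refine V.iso_closed _ _ (QuotientGroup.quotientKerEquivRange φ) ?_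
    refine V.iso_closed _ _ (QuotientGroup.quotientMulEquivOfEq hker.symm) hm
  rw [hrange] at h1
  refine V.extension_closed (G ⧸ N) (K.map (QuotientGroup.mk' N)) h1 ?_
  exact V.iso_closed _ _ (QuotientGroup.quotientQuotientEquivQuotient N K hNK).symm hKm

lemma coC_iInf {G : Type u} [Group G] {ι : Type*} [Finite ι] (hV : V.NE)
    {N : ι → Subgroup G} (h : ∀ i, N i ∈ V.coC G) : ⨅ i, N i ∈ V.coC G := by
  classical
  have : ∀ s : Set ι, s.Finite → (⨅ i ∈ s, N i) ∈ V.coC G := by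
    intro s hs
    induction s, hs using Set.Finite.induction_on with
    | empty => simpa using top_coC hV G
    | @insert a s ha hs ih => rw [iInf_insert]; exact coC_inf (h a) ih
  simpa using this Set.univ Set.finite_univ

lemma coC_fam {G : Type u} [Group G] {H K : Subgroup G} (hH : H ∈ V.coC G) (hK : K.Normal)
    (hKH : K ≤ H) {ι : Type*} [Finite ι] {Q : ι → Type u} [∀ i, Group (Q i)]
    (hQ : ∀ i, V.mem (Q i)) (χ : ∀ i, H →* Q i)
    (h : ∀ k : H, (k : G) ∈ K ↔ ∀ i, χ i k = 1) : K ∈ V.coC G := by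
  refine coC_ext hH hK hKH ?_
  have : K.subgroupOf H = ⨅ i, (χ i).ker := by
    ext k; simp [Subgroup.mem_subgroupOf, Subgroup.mem_iInf, h, MonoidHom.mem_ker]
  rw [this]
  exact coC_iInf (NE_of_coC hH) fun i => coC_of_hom (χ i) (hQ i) (fun g => Iff.rfl)

/-- transitivity -/
lemma coC_trans {G : Type u} [Group G] {K H : Subgroup G} (hK : K ∈ V.coC G) (hKH : K ≤ H)
    {N : Subgroup H} (hN : N ∈ V.coC H) :
    ∃ N' ∈ V.coC G, ∀ x ∈ N', ∃ h : x ∈ H, (⟨x, h⟩ : H) ∈ N := by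
  have hKn : K.Normal := hK.1
  -- N₀ : subgroup of K
  let N₀ : Subgroup K := N.comap (Subgroup.inclusion hKH)
  have hN₀ : N₀ ∈ V.coC K := coC_comap _ hN
  let c : G → (K →* K) := fun g => (MulAut.conjNormal g : MulAut K).toMonoidHom
  have hfin : Finite (G ⧸ K) := V.finite _ hK.2
  let N₁ : Subgroup G := (N₀.map K.subtype).normalCore
  have hmem : ∀ x : G, x ∈ N₀.map K.subtype ↔ ∃ h : x ∈ K, (⟨x, h⟩ : K) ∈ N₀ := by
    intro x; simp [Subgroup.mem_map]
  have hn0 : N₀.Normal := hN₀.1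
  have hle : N₁ ≤ N₀.map K.subtype := Subgroup.normalCore_le _
  refine ⟨N₁, ?_, ?_⟩
  · refine coC_ext hK inferInstance ?_ ?_
    · intro x hx
      obtain ⟨h, -⟩ := (hmem x).1 (hle hx)
      exact h
    · have : N₁.subgroupOf K = ⨅ q : G ⧸ K, N₀.comap (c q.out) := by
        ext ⟨x, hx⟩
        simp only [Subgroup.mem_subgroupOf, Subgroup.mem_iInf, Subgroup.mem_comap]
        constructor
        · intro h q
          obtain ⟨h1, h2⟩ := (hmem _).1 (h q.out)
          exact h2
        · intro h g
          rw [hmem]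
          refine ⟨hKn.conj_mem _ hx _, ?_⟩
          have hq := h (QuotientGroup.mk g)
          obtain ⟨k, hk⟩ := QuotientGroup.mk_out_eq_mul K g
          have := hn0.conj_mem _ hq ((⟨g * k * g⁻¹, hKn.conj_mem _ k.2 _⟩ : K)⁻¹)
          convert this using 1
          apply Subtype.ext
          simp only [c, MulEquiv.toMonoidHom_eq_coe, MonoidHom.coe_coe, Subgroup.coe_mul,
            MulAut.conjNormal_apply, Subgroup.coe_inv, hk]
          group
      rw [this]
      exact coC_iInf (NE_of_coC hK) fun q => coC_comap _ hN₀
  · intro x hx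
    obtain ⟨h, h'⟩ := (hmem x).1 (hle hx)
    exact ⟨hKH h, h'⟩

end basics
end ECPseudoVariety

namespace ECPseudoVariety
section crit
variable {V : ECPseudoVariety.{u}}

/-- orbit of `g` under conjugation by `K` -/
def cl {G : Type u} [Group G] (g : G) (K : Subgroup G) : Set G := {x | ∃ k ∈ K, x = k * g * k⁻¹}

lemma cl_closed_of_HCS {G : Type u} [Group G] (h : V.HCS G) {K : Subgroup G} (hK : K ∈ V.coC G)
    (g : G) : V.CSeparable (cl g K) := by
  have hKn : K.Normal := hK.1
  rw [csep_iff]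
  intro x hx
  let H : Subgroup G := K ⊔ Subgroup.zpowers g
  have hKH : K ≤ H := le_sup_left
  have hgH : g ∈ H := le_sup_right (a := K) (Subgroup.mem_zpowers g)
  have hH : V.COpen H := ⟨K, hK, hKH⟩
  by_cases hxH : x ∈ H
  · have hs := h.2 H hH ⟨g, hgH⟩
    rw [csep_iff] at hs
    obtain ⟨N, hN, hNs⟩ := hs ⟨x, hxH⟩ (by
      intro hc
      rw [Set.mem_ofPred_eq, isConj_iff] at hc
      obtain ⟨⟨c, hcH⟩, hc⟩ := hc
      have hc' : c * g * c⁻¹ = x := congrArg Subtype.val hc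
      have hcH' : c ∈ ((K ⊔ Subgroup.zpowers g : Subgroup G) : Set G) := hcH
      rw [Subgroup.normal_mul] at hcH'
      obtain ⟨k, hk, z, hz, rfl⟩ := Set.mem_mul.1 hcH'
      obtain ⟨j, rfl⟩ := Subgroup.mem_zpowers_iff.1 hz
      apply hx
      refine ⟨k, hk, ?_⟩
      rw [← hc']
      group)
    obtain ⟨N', hN', hNN⟩ := coC_trans hK hKH hN
    refine ⟨N', hN', ?_⟩
    rintro _ ⟨k, hk, rfl⟩ hc
    obtain ⟨h1, h2⟩ := hNN _ hc
    refine hNs (⟨k, hKH hk⟩ * ⟨g, hgH⟩ * ⟨k, hKH hk⟩⁻¹) ?_ h2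
    rw [Set.mem_ofPred_eq, isConj_iff]
    exact ⟨_, rfl⟩
  · refine ⟨K, hK, ?_⟩
    rintro _ ⟨k, hk, rfl⟩ hc
    apply hxH
    have h1 := H.mul_mem (H.mul_mem (H.mul_mem (hKH hk) hgH) (H.inv_mem (hKH hk))) (hKH hc)
    rwa [mul_inv_cancel_left] at h1

lemma csep_class {G : Type u} [Group G] {K : Subgroup G} (hK : K ∈ V.coC G)
    (h : ∀ g, V.CSeparable (cl g K)) {H : Subgroup G} (hKH : K ≤ H) : V.ConjSep H := by
  have hKn : K.Normal := hK.1
  have hfin : Finite (G ⧸ K) := V.finite _ hK.2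
  rintro ⟨g, hg⟩
  rw [csep_iff]
  rintro ⟨x, hx⟩ hxg
  obtain ⟨N, hN, hNK, hP⟩ := avoid (V := V) (G := G) (Set.univ : Set (G ⧸ K)) Set.finite_univ
    (fun q N => ∀ c ∈ H, (QuotientGroup.mk c : G ⧸ K) = q → (c * g * c⁻¹)⁻¹ * x ∉ N)
    (fun i N N' hN hP c hc hq hh => hP c hc hq (hN hh)) (by
      intro q _
      by_cases hq : ∃ c ∈ H, (QuotientGroup.mk c : G ⧸ K) = q
      · obtain ⟨c, hcH, rfl⟩ := hq
        have := csep_iff.1 (h (c * g * c⁻¹)) x (by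
          rintro ⟨k, hk, he⟩
          apply hxg
          rw [Set.mem_ofPred_eq, isConj_iff]
          refine ⟨⟨k * c, H.mul_mem (hKH hk) hcH⟩, ?_⟩
          apply Subtype.ext
          simp [he, mul_assoc])
        obtain ⟨N, hN, hh⟩ := this
        refine ⟨N, hN, ?_⟩
        intro d hd hdc hmem
        have h1 : d * c⁻¹ ∈ K := by
          have h2 := QuotientGroup.eq.1 hdc.symm
          have h3 := hKn.conj_mem _ h2 c
          simpa [mul_assoc] using h3
        refine hh (d * g * d⁻¹) ⟨_, h1, by group⟩ hmem
      · exact ⟨K, hK, fun c hc hcq => (hq ⟨c, hc, hcq⟩).elim⟩) hK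
  refine ⟨N.comap H.subtype, coC_comap _ hN, ?_⟩
  rintro ⟨y, hy⟩ hyc hmem
  rw [Set.mem_ofPred_eq, isConj_iff] at hyc
  obtain ⟨⟨c, hcH⟩, hc⟩ := hyc
  have hc' : c * g * c⁻¹ = y := congrArg Subtype.val hc
  subst hc'
  exact hP _ (Set.mem_univ _) c hcH rfl hmem

lemma conjSep_of_top {G : Type u} [Group G] (h : V.ConjSep (⊤ : Subgroup G)) : V.ConjSep G := by
  intro g
  have := csep_iff.1 (h ⟨g, trivial⟩)
  rw [csep_iff]
  intro x hx
  obtain ⟨N, hN, hh⟩ := this ⟨x, trivial⟩ (by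
    intro hc
    apply hx
    rw [Set.mem_ofPred_eq, isConj_iff] at hc ⊢
    obtain ⟨c, hc⟩ := hc
    exact ⟨c, congrArg Subtype.val hc⟩)
  refine ⟨N.comap (Subgroup.topEquiv.symm.toMonoidHom), coC_comap _ hN, ?_⟩
  intro y hy hmem
  refine hh ⟨y, trivial⟩ ?_ hmem
  rw [Set.mem_ofPred_eq, isConj_iff] at hy ⊢
  obtain ⟨c, rfl⟩ := hy
  exact ⟨⟨c, trivial⟩, rfl⟩

lemma HCS_of_cl (hV : V.NE) {G : Type u} [Group G]
    (h : ∀ K ∈ V.coC G, ∃ K' ∈ V.coC G, K' ≤ K ∧ ∀ g, V.CSeparable (cl g K')) : V.HCS G := by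
  have key : ∀ H : Subgroup G, V.COpen H → V.ConjSep H := by
    rintro H ⟨K, hK, hKH⟩
    obtain ⟨K', hK', hle, hc⟩ := h K hK
    exact csep_class hK' hc (hle.trans hKH)
  exact ⟨conjSep_of_top (key ⊤ ⟨⊤, top_coC hV G, le_rfl⟩), key⟩

lemma HCS_retract (hV : V.NE) {G R : Type u} [Group G] [Group R] (i : R →* G) (r : G →* R)
    (hri : ∀ x, r (i x) = x) (h : V.HCS G) : V.HCS R := by
  refine HCS_of_cl hV fun M hM => ⟨M, hM, le_rfl, fun g => ?_⟩
  have hc := csep_iff.1 (cl_closed_of_HCS h (coC_comap r hM) (i g))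
  rw [csep_iff]
  intro x hx
  obtain ⟨N, hN, hh⟩ := hc (i x) (by
    rintro ⟨k, hk, he⟩
    apply hx
    refine ⟨r k, hk, ?_⟩
    have := congrArg r he
    simpa [hri] using this)
  refine ⟨N.comap i, coC_comap _ hN, ?_⟩
  rintro _ ⟨k, hk, rfl⟩ hmem
  refine hh (i (k * g * k⁻¹)) ⟨i k, ?_, by simp⟩ (by simpa using hmem)
  simpa [hri] using hk

lemma HCS_equiv (hV : V.NE) {G R : Type u} [Group G] [Group R] (e : G ≃* R) (h : V.HCS G) :
    V.HCS R := HCS_retract hV e.symm.toMonoidHom e.toMonoidHom (by simp) h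

lemma residually_of_conjSep {G : Type u} [Group G] (h : V.ConjSep G) : V.Residually G := by
  intro g hg
  obtain ⟨N, hN, hh⟩ := csep_iff.1 (h 1) g (by simpa [isConj_iff, eq_comm] using hg)
  exact ⟨N, hN, by simpa using hh 1 (by simp)⟩

lemma residually_of_inj {G H : Type u} [Group G] [Group H] (φ : G →* H)
    (hφ : Function.Injective φ) (h : V.Residually H) : V.Residually G := by
  intro g hg
  obtain ⟨N, hN, hh⟩ := h (φ g) (by rwa [Ne, map_eq_one_iff φ hφ])
  exact ⟨_, coC_comap φ hN, hh⟩

/-- centralizer condition -/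
lemma CC {B : Type u} [Group B] (h : V.HCS B) (b : B) {M M2 : Subgroup B} 
    (hM2 : M2 ∈ V.coC B) (hle : M2 ≤ M) :
    ∃ M1 ∈ V.coC B, M1 ≤ M2 ∧ ∀ m ∈ M, (m * b * m⁻¹)⁻¹ * b ∈ M1 →
      ∃ c ∈ M, c * b = b * c ∧ m * c⁻¹ ∈ M2 := by
  have hn : M2.Normal := hM2.1
  have hfin : Finite (B ⧸ M2) := V.finite _ hM2.2
  obtain ⟨N, hN, hNK, hP⟩ := avoid (V := V) (G := B) (Set.univ : Set (B ⧸ M2)) Set.finite_univ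
    (fun q N => ∀ m ∈ M, (QuotientGroup.mk m : B ⧸ M2) = q → (m * b * m⁻¹)⁻¹ * b ∈ N →
      ∃ c ∈ M, c * b = b * c ∧ m * c⁻¹ ∈ M2)
    (fun i N N' hN hP c hc hq hh => hP c hc hq (hN hh)) (by
      intro q _
      by_cases hq : ∃ m ∈ M, (QuotientGroup.mk m : B ⧸ M2) = q ∧
          ¬ ∃ c ∈ M, c * b = b * c ∧ m * c⁻¹ ∈ M2
      · obtain ⟨m₀, hm₀, rfl, hno⟩ := hq
        obtain ⟨N, hN, hh⟩ := csep_iff.1 (cl_closed_of_HCS h hM2 b) (m₀ * b * m₀⁻¹) (by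
          rintro ⟨n, hn2, he⟩
          apply hno
          refine ⟨n⁻¹ * m₀, M.mul_mem (M.inv_mem (hle hn2)) hm₀, ?_, ?_⟩
          · have := congrArg (fun x => n⁻¹ * x * m₀) he
            simpa [mul_assoc] using this
          · simpa [mul_assoc] using hn2)
        have hNn := hN.1
        refine ⟨N, hN, ?_⟩
        intro m hm hmq hmem
        exfalso
        have h1 : m * m₀⁻¹ ∈ M2 := by
          have h3 := hn.conj_mem _ (QuotientGroup.eq.1 hmq.symm) m₀
          simpa [mul_assoc] using h3
        have h4 := hh ((m * m₀⁻¹)⁻¹ * b * (m * m₀⁻¹)⁻¹⁻¹) ⟨_, M2.inv_mem h1, rfl⟩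
        apply h4
        have h5 := N.inv_mem hmem
        have h6 := hNn.conj_mem _ h5 ((m * m₀⁻¹)⁻¹)
        convert h6 using 1
        group
      · push Not at hq
        exact ⟨M2, hM2, fun c hc hcq _ => hq c hc hcq⟩) hM2
  exact ⟨N, hN, hNK, fun m hm hh => hP _ (Set.mem_univ _) m hm rfl hh⟩

end crit
end ECPseudoVariety

/-- model of the unrestricted wreath product -/
@[ext] structure PW (A B : Type u) : Type u where
  l : B → A
  r : B

namespace PW
variable {A B : Type u} [Group A] [Group B]

instance : Mul (PW A B) := ⟨fun g h => ⟨fun x => g.l x * h.l (g.r⁻¹ * x), g.r * h.r⟩⟩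
instance : One (PW A B) := ⟨⟨fun _ => 1, 1⟩⟩
instance : Inv (PW A B) := ⟨fun g => ⟨fun x => (g.l (g.r * x))⁻¹, g.r⁻¹⟩⟩

@[simp] lemma mul_l (g h : PW A B) (x : B) : (g * h).l x = g.l x * h.l (g.r⁻¹ * x) := rfl
@[simp] lemma mul_r (g h : PW A B) : (g * h).r = g.r * h.r := rfl
@[simp] lemma one_l (x : B) : (1 : PW A B).l x = 1 := rfl
@[simp] lemma one_r : (1 : PW A B).r = 1 := rfl
@[simp] lemma inv_l (g : PW A B) (x : B) : (g⁻¹).l x = (g.l (g.r * x))⁻¹ := rfl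
@[simp] lemma inv_r (g : PW A B) : (g⁻¹).r = g.r⁻¹ := rfl

instance : Group (PW A B) := Group.ofLeftAxioms
  (by intro a b c; ext x <;> simp [mul_assoc])
  (by intro a; ext x <;> simp)
  (by intro a; ext x <;> simp)

def rHom : PW A B →* B where
  toFun := r
  map_one' := rfl
  map_mul' _ _ := rfl

def inl : (B → A) →* PW A B where
  toFun f := ⟨f, 1⟩
  map_one' := rfl
  map_mul' f g := by ext x <;> simp

def equiv [Finite B] : RWreath A B ≃* PW A B where
  toFun g := ⟨(g.left : B → A), g.right⟩
  invFun g := ⟨⟨g.l, Set.toFinite _⟩, g.r⟩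
  left_inv _ := rfl
  right_inv _ := rfl
  map_mul' _ _ := rfl

def KK (N : Subgroup A) : Subgroup (PW A B) where
  carrier := {g | g.r = 1 ∧ ∀ x, g.l x ∈ N}
  one_mem' := ⟨rfl, fun x => N.one_mem⟩
  mul_mem' := by
    rintro g h ⟨h1, h2⟩ ⟨h3, h4⟩
    exact ⟨by simp [h1, h3], fun x => N.mul_mem (h2 _) (h4 _)⟩
  inv_mem' := by
    rintro g ⟨h1, h2⟩
    exact ⟨by simp [h1], fun x => N.inv_mem (h2 _)⟩

lemma mem_KK {N : Subgroup A} {g : PW A B} : g ∈ KK N ↔ g.r = 1 ∧ ∀ x, g.l x ∈ N := Iff.rfl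

lemma KK_normal {N : Subgroup A} (hN : N.Normal) : (KK N : Subgroup (PW A B)).Normal := by
  constructor
  rintro k ⟨h1, h2⟩ g
  refine ⟨by simp [h1], fun x => ?_⟩
  simp only [mul_l, mul_r, h1, inv_l]
  have := hN.conj_mem _ (h2 (g.r⁻¹ * x)) (g.l x)
  simpa using this

variable {V : ECPseudoVariety.{u}}
open ECPseudoVariety

lemma KK_coC (hB : V.mem B) {N : Subgroup A} (hN : N ∈ V.coC A) :
    (KK N : Subgroup (PW A B)) ∈ V.coC (PW A B) := by
  have hNn := hN.1
  have : Finite B := V.finite _ hB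
  refine coC_fam (coC_comap rHom (bot_of_mem hB)) (KK_normal hNn) (fun g hg => hg.1)
    (ι := B) (Q := fun _ => A ⧸ N) (fun _ => hN.2)
    (fun x => 
      { toFun := fun h => QuotientGroup.mk (h.1.l x)
        map_one' := rfl
        map_mul' := by
          rintro ⟨g, hg⟩ ⟨h, hh⟩
          have hg1 : g.r = 1 := hg
          change (QuotientGroup.mk (g.l x * h.l (g.r⁻¹ * x)) : A ⧸ N) = _
          rw [hg1, inv_one, one_mul]
          rfl }) ?_
  rintro ⟨k, hk⟩
  have hk' : k.r = 1 := hk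
  rw [mem_KK]
  constructor
  · rintro ⟨_, h⟩ i
    exact (QuotientGroup.eq_one_iff _).2 (h i)
  · intro h
    exact ⟨hk', fun i => (QuotientGroup.eq_one_iff _).1 (h i)⟩

lemma KK_cofinal (hB : V.mem B) (K : Subgroup (PW A B)) (hK : K ∈ V.coC (PW A B)) :
    ∃ N ∈ V.coC A, KK N ≤ K := by
  classical
  have : Finite B := V.finite _ hB
  have hK' : K.comap inl ∈ V.coC (B → A) := coC_comap _ hK
  refine ⟨⨅ x : B, (K.comap inl).comap (MonoidHom.mulSingle (fun _ : B => A) x),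
    coC_iInf ⟨_, _, hB⟩ (fun x => coC_comap _ hK'), ?_⟩
  rintro ⟨f, b⟩ ⟨h1, h2⟩
  have h1' : b = 1 := h1
  subst h1'
  change f ∈ K.comap inl
  apply Subgroup.pi_mem_of_mulSingle_mem
  intro x
  exact (Subgroup.mem_iInf.1 (h2 x)) x

/-- partial product along `b`-orbit -/
def pr (b : B) (f : B → A) (x : B) : ℕ → A
  | 0 => 1
  | j + 1 => f (b ^ j * x) * pr b f x j

lemma pr_add (b : B) (f : B → A) (x : B) (n j : ℕ) :
    pr b f x (n + j) = pr b f (b ^ n * x) j * pr b f x n := by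
  induction j with
  | zero => simp [pr]
  | succ j ih => 
    rw [← add_assoc]
    simp only [pr, ih, mul_assoc]
    rw [← mul_assoc (b ^ j), ← pow_add, add_comm j n]

lemma pr_congr {N : Subgroup A} (hN : N.Normal) (b : B) (f t : B → A)
    (h : ∀ x, (f x)⁻¹ * t x ∈ N) (x : B) (j : ℕ) : (pr b f x j)⁻¹ * pr b t x j ∈ N := by
  induction j with
  | zero => simp [pr]
  | succ j ih => 
    simp only [← QuotientGroup.eq] at *
    simp only [pr, QuotientGroup.mk_mul, ih, h]

lemma pr_conj (b : B) (f k : B → A) (x : B) (j : ℕ) :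
    pr b (fun x => k x * f x * (k (b⁻¹ * x))⁻¹) x j =
      k (b⁻¹ * (b ^ j * x)) * pr b f x j * (k (b⁻¹ * x))⁻¹ := by
  induction j with
  | zero => simp [pr]
  | succ j ih => 
    simp only [pr, ih]
    have : b⁻¹ * (b ^ (j + 1) * x) = b ^ j * x := by rw [pow_succ']; group
    rw [this]; group

lemma exists_k {N : Subgroup A} (hN : N.Normal) [Finite B] (b : B) (f t : B → A)
    (h : ∀ x, (f x)⁻¹ * t x ∈ N)
    (h' : ∀ x, ∃ κ ∈ N, pr b t x (orderOf b) = κ * pr b f x (orderOf b) * κ⁻¹) :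
    ∃ k : B → A, (∀ x, k x ∈ N) ∧ ∀ x, t x = k x * f x * (k (b⁻¹ * x))⁻¹ := by
  choose κ hκ hκ' using h'
  let F : B → ℕ → A := fun x j => pr b t x j * κ x * (pr b f x j)⁻¹
  have hF : ∀ x, Function.Periodic (F x) (orderOf b) := by
    intro x j
    simp only [F]
    rw [add_comm, pr_add, pr_add, hκ', pow_orderOf_eq_one, one_mul]
    group
  have hF2 : ∀ x i j, b ^ i = b ^ j → F x i = F x j := by
    intro x i j hij
    rw [pow_eq_pow_iff_modEq] at hij
    rw [← (hF x).map_mod_nat i, ← (hF x).map_mod_nat j, hij]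
  have hFN : ∀ x j, F x j ∈ N := by
    intro x j
    have h1 := pr_congr hN b f t h x j
    have h2 := N.mul_mem (hN.conj_mem _ (hκ x) (pr b t x j)) (hN.conj_mem _ h1 (pr b f x j))
    convert h2 using 1
    simp only [F]; group
  -- representatives
  let s : Setoid B := QuotientGroup.rightRel (Subgroup.zpowers b)
  let rep : B → B := fun y => (Quotient.mk s y).out
  have hrep : ∀ y, ∃ j : ℕ, b * y = b ^ j * rep y := by
    intro y
    have h1 : s (rep y) y := Quotient.mk_out y
    rw [QuotientGroup.rightRel_apply] at h1
    have h2 := (Subgroup.zpowers b).mul_mem (Subgroup.mem_zpowers b) h1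
    rw [← mem_powers_iff_mem_zpowers, Submonoid.mem_powers_iff] at h2
    obtain ⟨j, hj⟩ := h2
    exact ⟨j, by rw [hj]; group⟩
  have hrep2 : ∀ y, rep (b⁻¹ * y) = rep y := by
    intro y
    simp only [rep]
    congr 1
    apply Quotient.sound
    change s _ _
    rw [QuotientGroup.rightRel_apply]
    simp
  choose j hj using hrep
  refine ⟨fun y => F (rep y) (j y), fun y => hFN _ _, fun y => ?_⟩
  simp only [hrep2]
  have h1 : y = b ^ (j (b⁻¹ * y)) * rep y := by
    rw [← hrep2 y, ← hj]; group
  set i := j (b⁻¹ * y) with hi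
  have h2 : F (rep y) (j y) = F (rep y) (i + 1) := by
    apply hF2
    have := hj y
    have h3 : b ^ j y = b * y * (rep y)⁻¹ := by rw [this]; group
    have h4 : b ^ i = y * (rep y)⁻¹ := by rw [eq_mul_inv_iff_mul_eq]; exact h1.symm
    rw [h3, pow_succ', h4, mul_assoc]
  rw [h2]
  have h3 : F (rep y) (i + 1) = t y * F (rep y) i * (f y)⁻¹ := by
    simp only [F, pr]
    rw [← h1]; group
  rw [h3]; group

lemma conj_l (g k : PW A B) (hk : k.r = 1) (x : B) :
    (k * g * k⁻¹).l x = k.l x * g.l x * (k.l (g.r⁻¹ * x))⁻¹ := by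
  simp [hk]

lemma HCS_of (hB : V.mem B) (hA : V.HCS A) : V.HCS (PW A B) := by
  have : Finite B := V.finite _ hB
  refine HCS_of_cl ⟨_, _, hB⟩ fun K hK => ?_
  obtain ⟨N, hN, hle⟩ := KK_cofinal hB K hK
  have hNn := hN.1
  refine ⟨KK N, KK_coC hB hN, hle, fun g => ?_⟩
  rw [csep_iff]
  intro x hx
  -- general consequence of congruence
  have gen : ∀ N₁ : Subgroup A, N₁.Normal → ∀ k ∈ (KK N : Subgroup (PW A B)),
      (k * g * k⁻¹)⁻¹ * x ∈ (KK N₁ : Subgroup (PW A B)) → g.r = x.r ∧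
      ∀ y, (k.l y * g.l y * (k.l (g.r⁻¹ * y))⁻¹)⁻¹ * x.l y ∈ N₁ := by
    intro N₁ hN₁ k hk hm
    have hkr : k.r = 1 := hk.1
    obtain ⟨h1, h2⟩ := hm
    have h1' : g.r = x.r := by
      simp only [mul_r, inv_r, hkr] at h1
      simpa [inv_mul_eq_one] using h1
    refine ⟨h1', fun y => ?_⟩
    have h3 := h2 (g.r⁻¹ * y)
    rw [mul_l, inv_l, inv_r, mul_r, mul_r, inv_r, hkr, conj_l _ _ hkr] at h3
    simpa using h3
  by_cases hr : g.r = x.r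
  swap
  · exact ⟨KK N, KK_coC hB hN, by rintro _ ⟨k, hk, rfl⟩ hm; exact hr (gen N hNn k hk hm).1⟩
  by_cases h1 : ∀ y, (g.l y)⁻¹ * x.l y ∈ N
  swap
  · refine ⟨KK N, KK_coC hB hN, ?_⟩
    rintro _ ⟨k, hk, rfl⟩ hm
    apply h1
    intro y
    have h3 := (gen N hNn k hk hm).2 y
    have hk1 := (QuotientGroup.eq_one_iff _).2 (hk.2 y)
    have hk2 := (QuotientGroup.eq_one_iff _).2 (hk.2 (g.r⁻¹ * y))
    rw [← QuotientGroup.eq] at h3 ⊢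
    simpa [hk1, hk2] using h3
  by_cases h2 : ∀ y, ∃ κ ∈ N, pr g.r x.l y (orderOf g.r) = κ * pr g.r g.l y (orderOf g.r) * κ⁻¹
  · exfalso
    obtain ⟨k, hk, hk'⟩ := exists_k hNn g.r g.l x.l h1 h2
    apply hx
    refine ⟨⟨k, 1⟩, ⟨rfl, hk⟩, ?_⟩
    ext y
    · rw [conj_l _ _ rfl, hk']
    · simp [hr]
  · push Not at h2
    obtain ⟨y, hy⟩ := h2
    obtain ⟨N₁, hN₁, hh⟩ := csep_iff.1 (cl_closed_of_HCS hA hN (pr g.r g.l y (orderOf g.r)))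
      (pr g.r x.l y (orderOf g.r)) (by rintro ⟨κ, hκ, he⟩; exact hy κ hκ he)
    refine ⟨KK N₁, KK_coC hB hN₁, ?_⟩
    rintro _ ⟨k, hk, rfl⟩ hm
    have h3 := (gen N₁ hN₁.1 k hk hm).2
    have h4 := pr_congr hN₁.1 g.r _ _ h3 y (orderOf g.r)
    rw [pr_conj, pow_orderOf_eq_one, one_mul] at h4
    exact hh _ ⟨k.l (g.r⁻¹ * y), hk.2 _, rfl⟩ h4

lemma HCS_base (hB : V.mem B) (h : V.HCS (PW A B)) : V.HCS A := by
  classical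
  refine HCS_of_cl ⟨_, _, hB⟩ fun N hN => ⟨N, hN, le_rfl, fun a => ?_⟩
  rw [csep_iff]
  intro a' ha'
  let i : A →* PW A B := inl.comp (MonoidHom.mulSingle (fun _ : B => A) 1)
  obtain ⟨M, hM, hh⟩ := csep_iff.1 (cl_closed_of_HCS h (KK_coC hB hN) (i a)) (i a') (by
    rintro ⟨k, hk, he⟩
    apply ha'
    have := congrArg (fun g => g.l 1) he
    simp only [conj_l _ _ hk.1] at this
    refine ⟨k.l 1, hk.2 1, ?_⟩
    simpa [i, inl] using this)
  refine ⟨M.comap i, coC_comap _ hM, ?_⟩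
  rintro _ ⟨κ, hκ, rfl⟩ hm
  refine hh (i (κ * a * κ⁻¹)) ⟨i κ, ⟨rfl, fun x => ?_⟩, by simp⟩ (by simpa using hm)
  change Pi.mulSingle (M := fun _ => A) (1 : B) κ x ∈ N
  by_cases hx : x = 1
  · subst hx; simpa using hκ
  · simp [hx]

end PW

namespace LWx
variable {A B : Type u} [AddCommGroup A] [Group B]

noncomputable def sh (b : B) : (B →₀ A) →+ (B →₀ A) := Finsupp.mapDomain.addMonoidHom (b * ·)

@[simp] lemma sh_single (b x : B) (a : A) :
    sh b (Finsupp.single x a) = Finsupp.single (b * x) a := Finsupp.mapDomain_single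

@[simp] lemma sh_one (w : B →₀ A) : sh 1 w = w := by
  change Finsupp.mapDomain _ _ = _
  simp only [one_mul]
  exact Finsupp.mapDomain_id

@[simp] lemma sh_sh (a b : B) (w : B →₀ A) : sh a (sh b w) = sh (a * b) w := by
  change Finsupp.mapDomain _ (Finsupp.mapDomain _ _) = Finsupp.mapDomain _ _
  rw [← Finsupp.mapDomain_comp]
  congr 1
  funext x
  simp [mul_assoc]

lemma sh_apply (b : B) (w : B →₀ A) (x : B) : sh b w x = w (b⁻¹ * x) := by
  have : x = b * (b⁻¹ * x) := by group
  conv_lhs => rw [this]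
  exact Finsupp.mapDomain_apply (mul_right_injective b) w _

open Classical in
/-- sum over a subset -/
noncomputable def sg (X : Set B) : (B →₀ A) →+ A :=
  Finsupp.liftAddHom (fun y => if y ∈ X then AddMonoidHom.id A else 0)

open Classical in
@[simp] lemma sg_single (X : Set B) (x : B) (a : A) :
    sg X (Finsupp.single x a) = if x ∈ X then a else 0 := by
  simp only [sg, Finsupp.liftAddHom_apply_single]
  split_ifs <;> simp

lemma hom_ext' {C : Type*} [AddCommGroup C] (φ ψ : (B →₀ A) →+ C)
    (h : ∀ x a, φ (Finsupp.single x a) = ψ (Finsupp.single x a)) (w) : φ w = ψ w := by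
  have : φ = ψ := Finsupp.addHom_ext h
  rw [this]

lemma sg_sh (X : Set B) (c : B) (w : B →₀ A) : sg X (sh c w) = sg {y | c * y ∈ X} w := by
  refine hom_ext' ((sg X).comp (sh c)) (sg {y | c * y ∈ X}) ?_ w
  intro x a
  simp

lemma sg_apply (X : Set B) (w : B →₀ A) [DecidablePred (· ∈ X)] :
    sg X w = ∑ y ∈ w.support, if y ∈ X then w y else 0 := by
  simp only [sg, Finsupp.liftAddHom_apply, Finsupp.sum]
  apply Finset.sum_congr rfl
  intro y _
  split_ifs <;> simp

lemma sg_congr {X Y : Set B} {w : B →₀ A} (h : ∀ y ∈ w.support, (y ∈ X ↔ y ∈ Y)) :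
    sg X w = sg Y w := by
  classical
  rw [sg_apply, sg_apply]
  apply Finset.sum_congr rfl
  intro y hy
  simp [h y hy]

lemma sg_zero {X : Set B} {w : B →₀ A} (h : ∀ y ∈ w.support, y ∉ X) : sg X w = 0 := by
  classical
  rw [sg_apply]
  apply Finset.sum_eq_zero
  intro y hy
  simp [h y hy]

lemma exists_of_sg_ne {X : Set B} {w : B →₀ A} (h : sg X w ≠ 0) : ∃ y ∈ w.support, y ∈ X := by
  by_contra hc
  push Not at hc
  exact h (sg_zero hc)

open Multiplicative in
/-- kernel of `A[B] → (A/N)[B/M]` -/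
noncomputable def LL (N : Subgroup (Multiplicative A)) (M : Subgroup B) : AddSubgroup (B →₀ A) where
  carrier := {w | ∀ X : Set B, (∀ y ∈ X, ∀ m ∈ M, y * m ∈ X) → ofAdd (sg X w) ∈ N}
  zero_mem' := by intro X _; simp
  add_mem' := by
    intro v w hv hw X hX
    rw [map_add, ofAdd_add]
    exact N.mul_mem (hv X hX) (hw X hX)
  neg_mem' := by
    intro v hv X hX
    rw [map_neg, ofAdd_neg]
    exact N.inv_mem (hv X hX)

open Multiplicative

variable {N N' : Subgroup (Multiplicative A)} {M M' : Subgroup B}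

lemma LL_mono (h : N ≤ N') (h' : M ≤ M') : (LL N M : AddSubgroup (B →₀ A)) ≤ LL N' M' :=
  fun _ hw X hX => h (hw X fun y hy m hm => hX y hy m (h' hm))

lemma sh_mem (c : B) {w : B →₀ A} (hw : w ∈ LL N M) : sh c w ∈ LL N M := by
  intro X hX
  rw [sg_sh]
  refine hw _ fun y hy m hm => ?_
  have := hX _ hy m hm
  simpa [mul_assoc] using this

lemma inv_left (hM : M.Normal) {X : Set B} (hX : ∀ y ∈ X, ∀ m ∈ M, y * m ∈ X) {m : B} (hm : m ∈ M)
    (y : B) : m * y ∈ X ↔ y ∈ X := by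
  constructor
  · intro h
    have := hX _ h _ (hM.conj_mem _ (M.inv_mem hm) y⁻¹)
    simpa [mul_assoc] using this
  · intro h
    have := hX _ h _ (hM.conj_mem _ hm y⁻¹)
    simpa [mul_assoc] using this

lemma sg_sh_inv (hM : M.Normal) {X : Set B} (hX : ∀ y ∈ X, ∀ m ∈ M, y * m ∈ X) {m : B} (hm : m ∈ M)
    (w : B →₀ A) : sg X (sh m w) = sg X w := by
  rw [sg_sh]
  exact sg_congr fun y _ => inv_left hM hX hm y

lemma sh_sub_mem (hM : M.Normal) {m : B} (hm : m ∈ M) (w : B →₀ A) : sh m w - w ∈ LL N M := by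
  intro X hX
  rw [map_sub, sg_sh_inv hM hX hm, sub_self]
  exact N.one_mem

lemma sub_sh_mem (hM : M.Normal) {m : B} (hm : m ∈ M) (w : B →₀ A) : w - sh m w ∈ LL N M := by
  rw [← neg_sub]; exact (LL N M).neg_mem (sh_sub_mem hM hm w)

/-- Lemma D -/
lemma LL_le (T : AddSubgroup (B →₀ A)) 
    (h1 : ∀ x a, ofAdd a ∈ N → Finsupp.single x a ∈ T)
    (h2 : ∀ x a, ∀ m ∈ M, Finsupp.single x a - Finsupp.single (x * m) a ∈ T)
    {w : B →₀ A} (hw : ∀ x, ofAdd (sg {y | x⁻¹ * y ∈ M} w) ∈ N) : w ∈ T := by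
  classical
  let s : B → B := fun x => (QuotientGroup.mk x : B ⧸ M).out
  have hs : ∀ x, x⁻¹ * s x ∈ M := by
    intro x
    rw [← QuotientGroup.eq]
    exact (QuotientGroup.out_eq' _).symm
  have hs2 : ∀ x y, x⁻¹ * y ∈ M → s x = s y := by
    intro x y h
    simp only [s]
    rw [QuotientGroup.eq.2 h]
  have e1 : ∀ v : B →₀ A, v - Finsupp.mapDomain s v ∈ T := by
    intro v
    induction v using Finsupp.induction_linear with
    | zero => simp
    | add v w hv hw =>
      rw [Finsupp.mapDomain_add, add_sub_add_comm]
      exact T.add_mem hv hw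
    | single x a =>
      rw [Finsupp.mapDomain_single]
      have := h2 x a _ (hs x)
      simpa using this
  have e2 : ∀ (v : B →₀ A) x, Finsupp.mapDomain s v x = if s x = x then sg {y | x⁻¹ * y ∈ M} v else 0 := by
    intro v x
    split_ifs with hx
    · refine hom_ext' ((Finsupp.applyAddHom x).comp (Finsupp.mapDomain.addMonoidHom s))
        (sg {y | x⁻¹ * y ∈ M}) ?_ v
      intro y a
      simp only [AddMonoidHom.comp_apply, Finsupp.mapDomain.addMonoidHom_apply,
        Finsupp.mapDomain_single, Finsupp.applyAddHom_apply, sg_single, Set.mem_ofPred_eq,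
        Finsupp.single_apply]
      congr 1
      apply propext
      constructor
      · rintro rfl
        have := M.inv_mem (hs y)
        simpa using this
      · intro h
        rw [← hs2 x y h, hx]
    · apply Finsupp.mapDomain_of_not_mem_image_support
      rintro ⟨y, -, rfl⟩
      exact hx (hs2 _ _ (by have := M.inv_mem (hs y); simpa using this))
  have e3 : Finsupp.mapDomain s w ∈ T := by
    rw [← Finsupp.sum_single (Finsupp.mapDomain s w)]
    refine T.sum_mem fun x _ => h1 x _ ?_
    rw [e2]
    split_ifs
    · exact hw x
    · exact N.one_mem
  have := T.add_mem (e1 w) e3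
  simpa using this

lemma single_mem (x : B) {a : A} (ha : ofAdd a ∈ N) : Finsupp.single x a ∈ LL N M := by
  intro X _
  rw [sg_single]
  split_ifs
  · exact ha
  · exact N.one_mem

lemma single_sub_mem (x : B) (a : A) {m : B} (hm : m ∈ M) :
    Finsupp.single x a - Finsupp.single (x * m) a ∈ LL N M := by
  intro X hX
  rw [map_sub, sg_single, sg_single]
  have : x * m ∈ X ↔ x ∈ X := by
    constructor
    · intro h
      simpa using hX _ h _ (M.inv_mem hm)
    · intro h; exact hX _ h _ hm
  by_cases hx : x ∈ X
  · have hx2 := this.2 hx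
    simp [hx, hx2]
  · have hx2 : x * m ∉ X := fun h => hx (this.1 h)
    simp [hx, hx2]

lemma mem_LL {w : B →₀ A} (hw : ∀ x, ofAdd (sg {y | x⁻¹ * y ∈ M} w) ∈ N) : w ∈ LL N M :=
  LL_le _ (fun x _ h => single_mem x h) (fun x a _ h => single_sub_mem x a h) hw

/-- `single x a - single (b^k x) a` lies in `(1-b) A[B]` -/
lemma exists_telescope (b x : B) (a : A) (k : ℤ) :
    ∃ v : B →₀ A, Finsupp.single x a - Finsupp.single (b ^ k * x) a = v - sh b v := by
  induction k using Int.induction_on with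
  | zero => exact ⟨0, by simp⟩
  | succ k ih =>
    obtain ⟨v, hv⟩ := ih
    refine ⟨v + Finsupp.single (b ^ (k : ℤ) * x) a, ?_⟩
    rw [map_add, sh_single, add_sub_add_comm, ← hv, ← mul_assoc, ← zpow_one_add, add_comm 1 (k : ℤ)]
    abel
  | pred k ih =>
    obtain ⟨v, hv⟩ := ih
    refine ⟨v - Finsupp.single (b ^ (-(k : ℤ) - 1) * x) a, ?_⟩
    rw [map_sub, sh_single, sub_sub_sub_comm, ← hv, ← mul_assoc, ← zpow_one_add]
    rw [show 1 + (-(k : ℤ) - 1) = -(k : ℤ) by ring]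
    abel

def Zc (b x : B) : Set B := {y | y * x⁻¹ ∈ Subgroup.zpowers b}

/-- coset sums zero implies in `(1-b)A[B]` -/
lemma exists_of_coset_zero (b : B) (w : B →₀ A) (h : ∀ x, sg (Zc b x) w = 0) :
    ∃ v, w = v - sh b v := by
  classical
  let s : Setoid B := QuotientGroup.rightRel (Subgroup.zpowers b)
  let q : B → Quotient s := Quotient.mk s
  have hq : ∀ x y, q x = q y ↔ y * x⁻¹ ∈ Subgroup.zpowers b := by
    intro x y
    rw [← QuotientGroup.rightRel_apply]
    exact Quotient.eq
  let rep : B → B := fun x => (q x).out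
  have hrep : ∀ x, rep x * x⁻¹ ∈ Subgroup.zpowers b := by
    intro x
    rw [← hq]
    exact (Quotient.out_eq _).symm
  have e1 : ∀ v : B →₀ A, ∃ u, v - Finsupp.mapDomain rep v = u - sh b u := by
    intro v
    induction v using Finsupp.induction_linear with
    | zero => exact ⟨0, by simp⟩
    | add v w hv hw =>
      obtain ⟨u, hu⟩ := hv
      obtain ⟨u', hu'⟩ := hw
      refine ⟨u + u', ?_⟩
      rw [Finsupp.mapDomain_add, add_sub_add_comm, hu, hu', map_add]
      abel
    | single x a =>
      rw [Finsupp.mapDomain_single]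
      obtain ⟨k, hk⟩ := Subgroup.mem_zpowers_iff.1 (hrep x)
      have := exists_telescope b x a k
      rw [hk] at this
      simpa using this
  have e2 : ∀ (v : B →₀ A) x, Finsupp.mapDomain q v (q x) = sg (Zc b x) v := by
    intro v x
    refine hom_ext' ((Finsupp.applyAddHom (q x)).comp (Finsupp.mapDomain.addMonoidHom q))
        (sg (Zc b x)) ?_ v
    intro y a
    simp only [AddMonoidHom.comp_apply, Finsupp.mapDomain.addMonoidHom_apply,
        Finsupp.mapDomain_single, Finsupp.applyAddHom_apply, sg_single, Zc, Set.mem_ofPred_eq,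
        Finsupp.single_apply]
    congr 1
    apply propext
    rw [← hq]
    exact eq_comm
  have e3 : Finsupp.mapDomain q w = 0 := by
    ext z
    induction z using Quotient.inductionOn with
    | h x => 
      change Finsupp.mapDomain q w (q x) = 0
      rw [e2, h]
  have e4 : Finsupp.mapDomain rep w = 0 := by
    have : rep = Quotient.out ∘ q := rfl
    rw [this, Finsupp.mapDomain_comp, e3, Finsupp.mapDomain_zero]
  obtain ⟨u, hu⟩ := e1 w
  exact ⟨u, by rw [← hu, e4, sub_zero]⟩

end LWx

/-- model of the restricted wreath product, abelian base -/
@[ext] structure LW (A B : Type u) [AddCommGroup A] [Group B] : Type u where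
  l : B →₀ A
  r : B

namespace LW
open LWx Multiplicative
variable {A B : Type u} [AddCommGroup A] [Group B]

noncomputable instance : Mul (LW A B) := ⟨fun g h => ⟨g.l + sh g.r h.l, g.r * h.r⟩⟩
noncomputable instance : One (LW A B) := ⟨⟨0, 1⟩⟩
noncomputable instance : Inv (LW A B) := ⟨fun g => ⟨- sh g.r⁻¹ g.l, g.r⁻¹⟩⟩

@[simp] lemma mul_l (g h : LW A B) : (g * h).l = g.l + sh g.r h.l := rfl
@[simp] lemma mul_r (g h : LW A B) : (g * h).r = g.r * h.r := rfl
@[simp] lemma one_l : (1 : LW A B).l = 0 := rfl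
@[simp] lemma one_r : (1 : LW A B).r = 1 := rfl
@[simp] lemma inv_l (g : LW A B) : (g⁻¹).l = - sh g.r⁻¹ g.l := rfl
@[simp] lemma inv_r (g : LW A B) : (g⁻¹).r = g.r⁻¹ := rfl

noncomputable instance : Group (LW A B) := Group.ofLeftAxioms
  (by intro a b c; apply LW.ext <;> simp [mul_assoc, add_assoc])
  (by intro a; apply LW.ext <;> simp)
  (by intro a; apply LW.ext <;> simp)

noncomputable def rHom : LW A B →* B where
  toFun := r
  map_one' := rfl
  map_mul' _ _ := rfl

noncomputable def inr : B →* LW A B where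
  toFun b := ⟨0, b⟩
  map_one' := rfl
  map_mul' _ _ := by apply LW.ext <;> simp

noncomputable def inl : Multiplicative (B →₀ A) →* LW A B where
  toFun f := ⟨toAdd f, 1⟩
  map_one' := rfl
  map_mul' _ _ := by apply LW.ext <;> simp

lemma inr_l (b : B) : (inr b : LW A B).l = 0 := rfl
lemma inr_r (b : B) : (inr b : LW A B).r = b := rfl

lemma conj_l (g k : LW A B) : (k * g * k⁻¹).l = k.l + sh k.r g.l - sh (k.r * g.r * k.r⁻¹) k.l := by
  simp [sub_eq_add_neg]

noncomputable def equiv {A B : Type u} [CommGroup A] [Group B] : RWreath A B ≃* LW (Additive A) B where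
  toFun g := ⟨Finsupp.ofSupportFinite (fun x => Additive.ofMul ((g.left : B → A) x)) g.left.2, g.right⟩
  invFun g := ⟨⟨fun x => (g.l x).toMul, g.l.hasFiniteSupport⟩, g.r⟩
  left_inv _ := rfl
  right_inv _ := by
    apply LW.ext
    · ext x; rfl
    · rfl
  map_mul' g h := by
    apply LW.ext
    · ext x
      rw [mul_l, Finsupp.add_apply, sh_apply]
      rfl
    · rfl

variable {N N' : Subgroup (Multiplicative A)} {M M' : Subgroup B}

noncomputable def KK (N : Subgroup (Multiplicative A)) (M : Subgroup B) : Subgroup (LW A B) where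
  carrier := {g | g.r ∈ M ∧ g.l ∈ LL N M}
  one_mem' := ⟨M.one_mem, (LL N M).zero_mem⟩
  mul_mem' := by
    rintro g h ⟨h1, h2⟩ ⟨h3, h4⟩
    exact ⟨M.mul_mem h1 h3, (LL N M).add_mem h2 (sh_mem _ h4)⟩
  inv_mem' := by
    rintro g ⟨h1, h2⟩
    exact ⟨M.inv_mem h1, (LL N M).neg_mem (sh_mem _ h2)⟩

lemma mem_KK {g : LW A B} : g ∈ KK N M ↔ g.r ∈ M ∧ g.l ∈ LL N M := Iff.rfl

lemma KK_normal (hM : M.Normal) : (KK N M : Subgroup (LW A B)).Normal := by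
  constructor
  rintro k ⟨h1, h2⟩ g
  refine ⟨hM.conj_mem _ h1 g.r, ?_⟩
  rw [conj_l]
  have h3 := sub_sh_mem (N := N) hM (hM.conj_mem _ h1 g.r) g.l
  have := (LL N M).add_mem h3 (sh_mem g.r h2)
  convert this using 1
  abel

variable {V : ECPseudoVariety.{u}}
open ECPseudoVariety

lemma KK_coC (hN : N ∈ V.coC (Multiplicative A)) (hM : M ∈ V.coC B) :
    (KK N M : Subgroup (LW A B)) ∈ V.coC (LW A B) := by
  have hMn := hM.1
  have hNn := hN.1
  have : Finite (B ⧸ M) := V.finite _ hM.2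
  have hX : ∀ X : Set (B ⧸ M), ∀ y ∈ (QuotientGroup.mk ⁻¹' X : Set B), ∀ m ∈ M,
      y * m ∈ (QuotientGroup.mk ⁻¹' X : Set B) := by
    intro X y hy m hm
    have : (QuotientGroup.mk (y * m) : B ⧸ M) = QuotientGroup.mk y := by
      rw [eq_comm, QuotientGroup.eq]; simpa using hm
    rw [Set.mem_preimage, this]; exact hy
  refine coC_fam (coC_comap rHom hM) (KK_normal hMn) (fun g hg => hg.1)
    (ι := Set (B ⧸ M)) (Q := fun _ => Multiplicative A ⧸ N) (fun _ => hN.2)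
    (fun X => 
      { toFun := fun h => QuotientGroup.mk (ofAdd (sg (QuotientGroup.mk ⁻¹' X) h.1.l))
        map_one' := by
          change QuotientGroup.mk (ofAdd (sg (QuotientGroup.mk ⁻¹' X) 0)) = _
          rw [map_zero]; rfl
        map_mul' := by
          rintro ⟨g, hg⟩ ⟨h, hh⟩
          have hg1 : g.r ∈ M := hg
          change (QuotientGroup.mk (ofAdd (sg (QuotientGroup.mk ⁻¹' X) (g.l + sh g.r h.l))) : 
            Multiplicative A ⧸ N) = _
          rw [map_add, sg_sh_inv hMn (hX X) hg1]
          rfl }) ?_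
  rintro ⟨k, hk⟩
  rw [mem_KK]
  constructor
  · rintro ⟨_, h⟩ X
    exact (QuotientGroup.eq_one_iff _).2 (h _ (hX X))
  · intro h
    refine ⟨hk, mem_LL fun x => ?_⟩
    have := (QuotientGroup.eq_one_iff _).1 (h {(QuotientGroup.mk x : B ⧸ M)})
    have he : (QuotientGroup.mk ⁻¹' {(QuotientGroup.mk x : B ⧸ M)} : Set B) = {y | x⁻¹ * y ∈ M} := by
      ext y
      simp only [Set.mem_preimage, Set.mem_singleton_iff, Set.mem_ofPred_eq]
      rw [eq_comm, QuotientGroup.eq]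
    rw [he] at this
    exact this

lemma KK_cofinal (K : Subgroup (LW A B)) (hK : K ∈ V.coC (LW A B)) :
    ∃ N ∈ V.coC (Multiplicative A), ∃ M ∈ V.coC B, KK N M ≤ K := by
  have hKn := hK.1
  let j : Multiplicative A →* LW A B := inl.comp (AddMonoidHom.toMultiplicative (Finsupp.singleAddHom (1 : B)))
  refine ⟨K.comap j, coC_comap _ hK, K.comap inr, coC_comap _ hK, ?_⟩
  let T : AddSubgroup (B →₀ A) := Subgroup.toAddSubgroup' (K.comap inl)
  have hT : ∀ w, w ∈ T ↔ (⟨w, 1⟩ : LW A B) ∈ K := fun w => Iff.rfl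
  rintro ⟨l, m⟩ ⟨hm, hl⟩
  have h1 : l ∈ T := by
    refine LL_le (N := K.comap j) (M := K.comap inr) T ?_ ?_ (fun x => hl _ ?_)
    · intro x a ha
      rw [hT]
      have := hKn.conj_mem _ ha (inr x)
      convert this using 1
      apply LW.ext <;> simp [j, inl, inr]
    · intro x a m hm
      have hmK : (inr m : LW A B) ∈ K := hm
      have hm' : (inr (x * m * x⁻¹) : LW A B) ∈ K := by
        have := hKn.conj_mem _ hmK (inr x)
        simpa using this
      rw [hT]
      have h2 := K.mul_mem (hKn.conj_mem _ hm' ⟨Finsupp.single x a, 1⟩) (K.inv_mem hm')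
      convert h2 using 1
      apply LW.ext <;> simp [inr, sub_eq_add_neg, mul_assoc]
    · intro y hy m hm
      have := (K.comap inr).mul_mem hy hm
      rw [mul_assoc] at this
      exact this
  rw [hT] at h1
  have := K.mul_mem h1 (show inr m ∈ K from hm)
  convert this using 1
  apply LW.ext <;> simp [inr]

end LW

namespace LWx
open Multiplicative ECPseudoVariety
variable {A B : Type u} [AddCommGroup A] [Group B]
variable {N N' : Subgroup (Multiplicative A)} {M M' : Subgroup B}

noncomputable def gsum (b : B) (n : ℕ) (x : B) (a : A) : B →₀ A :=
  ∑ j ∈ Finset.range n, Finsupp.single (b ^ j * x) a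

lemma gsum_sub (b : B) (n : ℕ) (x : B) (a : A) :
    gsum b n x a - sh b (gsum b n x a) = Finsupp.single x a - Finsupp.single (b ^ n * x) a := by
  induction n with
  | zero => simp [gsum]
  | succ n ih =>
    have : gsum b (n + 1) x a = gsum b n x a + Finsupp.single (b ^ n * x) a := by
      simp [gsum, Finset.sum_range_succ]
    rw [this, map_add, add_sub_add_comm, ih, sh_single, ← mul_assoc, ← pow_succ']
    abel

lemma single_pow_mem (hM : M.Normal) (b : B) (n : ℕ) (hn : b ^ n ∈ M) (x : B) (a : A) :
    Finsupp.single x a - Finsupp.single (b ^ n * x) a ∈ LL N M := by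
  have := single_sub_mem (N := N) x a (hM.conj_mem _ hn x⁻¹)
  simpa [mul_assoc] using this

lemma reduce (hM : M.Normal) [Finite (B ⧸ M)] (b : B) (T : AddSubgroup (B →₀ A))
    (hT : LL N M ≤ T) (hg : ∀ x a, gsum b (orderOf (QuotientGroup.mk b : B ⧸ M)) x a ∈ T) :
    ∀ u : B →₀ A, u - sh b u ∈ LL N M → u ∈ T := by
  classical
  set n := orderOf (QuotientGroup.mk b : B ⧸ M) with hn
  have hn0 : 0 < n := orderOf_pos _
  have hbn : b ^ n ∈ M := by
    rw [← QuotientGroup.eq_one_iff, QuotientGroup.mk_pow, pow_orderOf_eq_one]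
  let S : B ⧸ M → Set B := fun q => {y | (QuotientGroup.mk y : B ⧸ M) = q}
  have hS : ∀ q, ∀ y ∈ S q, ∀ m ∈ M, y * m ∈ S q := by
    intro q y hy m hm
    have : (QuotientGroup.mk (y * m) : B ⧸ M) = QuotientGroup.mk y := by
      rw [eq_comm, QuotientGroup.eq]; simpa using hm
    change (QuotientGroup.mk (y * m) : B ⧸ M) = q
    rw [this]; exact hy
  let bad : (B →₀ A) → Set (B ⧸ M) := fun u => {q | ofAdd (sg (S q) u) ∉ N}
  have key : ∀ k : ℕ, ∀ u : B →₀ A, (bad u).ncard = k → u - sh b u ∈ LL N M → u ∈ T := by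
    intro k
    induction k using Nat.strong_induction_on with
    | _ k ih =>
    intro u huk hu
    by_cases hb : bad u = ∅
    · apply hT
      refine mem_LL fun x => ?_
      have h1 : (QuotientGroup.mk x : B ⧸ M) ∉ bad u := by rw [hb]; simp
      have h2 : ofAdd (sg (S (QuotientGroup.mk x)) u) ∈ N := by
        by_contra h; exact h1 h
      have he : S (QuotientGroup.mk x) = {y | x⁻¹ * y ∈ M} := by
        ext y
        simp only [S, Set.mem_ofPred_eq]
        rw [eq_comm, QuotientGroup.eq]
      rwa [he] at h2
    · obtain ⟨q, hq⟩ := Set.nonempty_iff_ne_empty.2 hb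
      obtain ⟨x, rfl⟩ := QuotientGroup.mk_surjective q
      set a := sg (S (QuotientGroup.mk x)) u with ha
      have hcong : ∀ j : ℕ, ofAdd (sg (S (QuotientGroup.mk (b ^ j * x))) u - a) ∈ N := by
        intro j
        induction j with
        | zero => simp [ha]
        | succ j ihj =>
          have h1 := hu _ (hS (QuotientGroup.mk (b ^ (j + 1) * x)))
          rw [map_sub, sg_sh] at h1
          have he : {y | b * y ∈ S (QuotientGroup.mk (b ^ (j + 1) * x))} =
              S (QuotientGroup.mk (b ^ j * x)) := by
            ext y
            simp only [S, Set.mem_ofPred_eq]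
            rw [QuotientGroup.eq, QuotientGroup.eq, pow_succ']
            simp [mul_assoc]
          rw [he] at h1
          have h2 := N.mul_mem h1 ihj
          rw [← ofAdd_add] at h2
          simpa using h2
      have hsum : ∀ q', sg (S q') (gsum b n x a) =
          ∑ j ∈ Finset.range n, if (QuotientGroup.mk (b ^ j * x) : B ⧸ M) = q' then a else 0 := by
        intro q'
        simp only [gsum, map_sum, sg_single, S, Set.mem_ofPred_eq]
        refine Finset.sum_congr rfl fun j _ => ?_
        congr
      have hinj : ∀ i < n, ∀ j < n, (QuotientGroup.mk (b ^ i * x) : B ⧸ M) = QuotientGroup.mk (b ^ j * x) →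
          i = j := by
        intro i hi j hj hij
        simp only [QuotientGroup.mk_mul, QuotientGroup.mk_pow, mul_left_inj] at hij
        exact pow_injOn_Iio_orderOf hi hj hij
      have h1 : ∀ j < n, (QuotientGroup.mk (b ^ j * x) : B ⧸ M) ∉ bad (u - gsum b n x a) := by
        intro j hj hbad
        apply hbad
        rw [map_sub, hsum, Finset.sum_eq_single j]
        · simpa using hcong j
        · intro i hi hij
          rw [if_neg]
          intro h
          exact hij (hinj i (Finset.mem_range.1 hi) j hj h)
        · intro h; exact (h (Finset.mem_range.2 hj)).elim
      have hsub : bad (u - gsum b n x a) ⊂ bad u := by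
        rw [Set.ssubset_iff_of_subset]
        · refine ⟨_, hq, ?_⟩
          have := h1 0 hn0
          simpa using this
        · intro q' hq'
          have h0 : sg (S q') (gsum b n x a) = 0 := by
            rw [hsum]
            apply Finset.sum_eq_zero
            intro j hj
            rw [if_neg]
            rintro rfl
            exact h1 j (Finset.mem_range.1 hj) hq'
          intro hc
          apply hq'
          rw [map_sub, h0, sub_zero]
          exact hc
      have h2 := ih _ (by rw [← huk]; exact Set.ncard_lt_ncard hsub (Set.toFinite _)) _ rfl (by
        rw [map_sub, sub_sub_sub_comm, gsum_sub]
        exact (LL N M).sub_mem hu (single_pow_mem hM b n hbn x a))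
      have := T.add_mem h2 (hg x a)
      simpa using this
  exact fun u hu => key _ u rfl hu

variable {V : ECPseudoVariety.{u}}

lemma residually_of_cyc (hcyc : V.CyclicSep B) : V.Residually B := by
  intro g hg
  obtain ⟨N, hN, hh⟩ := csep_iff.1 (hcyc 1) g (by simpa using hg)
  exact ⟨N, hN, by simpa using hh 1 (by simp)⟩

lemma sum_periodic (c : ℕ → A) (n : ℕ) (hc : ∀ j, c (j + n) = c j) (p : ℕ) :
    ∑ j ∈ Finset.range (n * p), c j = p • ∑ j ∈ Finset.range n, c j := by
  have hc' : ∀ q j, c (n * q + j) = c j := by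
    intro q
    induction q with
    | zero => simp
    | succ q ih => 
      intro j
      rw [show n * (q + 1) + j = (n * q + j) + n by ring, hc, ih]
  induction p with
  | zero => simp
  | succ p ih =>
    rw [Nat.mul_succ, Finset.sum_range_add, ih, succ_nsmul]
    simp only [hc']

lemma ord (hcyc : V.CyclicSep B) (hN : N ∈ V.coC (Multiplicative A)) (hM : M ∈ V.coC B) (b : B) :
    ∃ M2 ∈ V.coC B, M2 ≤ M ∧ ∀ M3 ≤ M2, ∀ n, b ^ n ∈ M3 → ∀ (x : B) (a : A),
      ∃ u', sh b u' = u' ∧ gsum b n x a - u' ∈ LL N M := by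
  have hMn := hM.1
  have hNn := hN.1
  by_cases hb : IsOfFinOrder b
  · have hfin : {z : B | z ∈ Subgroup.zpowers b ∧ z ≠ 1}.Finite := by
      refine Set.Finite.subset (s := (Subgroup.zpowers b : Set B)) ?_ (fun z hz => hz.1)
      exact finite_zpowers.2 hb
    obtain ⟨M2, hM2, hle, hP⟩ := avoid (V := V) _ hfin (fun z K => z ∉ K)
      (fun i K K' hK h hh => h (hK hh)) (fun z hz => residually_of_cyc hcyc z hz.2) hM
    refine ⟨M2, hM2, hle, fun M3 hM3 n hn x a => ⟨gsum b n x a, ?_, by simp⟩⟩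
    have h1 : b ^ n = 1 := by
      by_contra h
      exact hP (b ^ n) ⟨Subgroup.npow_mem_zpowers b n, h⟩ (hM3 hn)
    have := gsum_sub b n x a
    rw [h1, one_mul, sub_self, sub_eq_zero] at this
    exact this.symm
  · have hfM : Finite (B ⧸ M) := V.finite _ hM.2
    have hfN : Finite (Multiplicative A ⧸ N) := V.finite _ hN.2
    have hMi : M.index ≠ 0 := Subgroup.index_ne_zero_of_finite
    have hNi : N.index ≠ 0 := Subgroup.index_ne_zero_of_finite
    set k := M.index * N.index with hk
    have hk0 : 0 < k := Nat.pos_of_ne_zero (mul_ne_zero hMi hNi)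
    have hfin : {j : ℕ | 0 < j ∧ j < k}.Finite := (Set.finite_Iio k).subset (fun j hj => hj.2)
    obtain ⟨M2, hM2, hle, hP⟩ := avoid (V := V) _ hfin
      (fun j K => ∀ z ∈ Subgroup.zpowers (b ^ k), z⁻¹ * b ^ j ∉ K)
      (fun i K K' hK h z hz hh => h z hz (hK hh)) (fun j hj => by
        refine csep_iff.1 (hcyc (b ^ k)) (b ^ j) ?_
        intro hmem
        obtain ⟨i, hi⟩ := Subgroup.mem_zpowers_iff.1 hmem
        rw [← zpow_natCast, ← zpow_natCast, ← zpow_mul] at hi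
        have := injective_zpow_iff_not_isOfFinOrder.2 hb hi
        have hd : (k : ℤ) ∣ (j : ℤ) := ⟨i, this.symm⟩
        have hd' := Nat.le_of_dvd hj.1 (Int.natCast_dvd_natCast.1 hd)
        have := hj.2
        omega) hM
    refine ⟨M2, hM2, hle, fun M3 hM3 n hn x a => ⟨0, by simp, ?_⟩⟩
    have hkn : k ∣ n := by
      rw [Nat.dvd_iff_mod_eq_zero]
      by_contra h
      refine hP (n % k) ⟨Nat.pos_of_ne_zero h, Nat.mod_lt _ hk0⟩ ((b ^ k) ^ (n / k))⁻¹
        ((Subgroup.zpowers _).inv_mem (Subgroup.npow_mem_zpowers _ _)) ?_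
      rw [inv_inv, ← pow_mul, ← pow_add, Nat.div_add_mod]
      exact hM3 hn
    obtain ⟨q, rfl⟩ := hkn
    rw [sub_zero]
    intro X hX
    classical
    simp only [gsum, map_sum, sg_single]
    rw [hk, mul_assoc, sum_periodic, ofAdd_nsmul, pow_mul]
    · exact N.pow_mem (Subgroup.pow_index_mem N _) _
    · intro j
      have : b ^ (j + M.index) * x ∈ X ↔ b ^ j * x ∈ X := by
        rw [pow_add, (Commute.pow_pow_self b j M.index).eq, mul_assoc]
        exact inv_left hMn hX (Subgroup.pow_index_mem M b) _
      simp only [this]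

end LWx

namespace LWx
open Multiplicative ECPseudoVariety
variable {A B : Type u} [AddCommGroup A] [Group B]
variable {N N' : Subgroup (Multiplicative A)} {M M' : Subgroup B}

def Cs (H : Subgroup B) (x : B) : Set B := {y | y * x⁻¹ ∈ H}

lemma mem_Cs {H : Subgroup B} {x y : B} : y ∈ Cs H x ↔ y * x⁻¹ ∈ H := Iff.rfl

lemma Cs_self (H : Subgroup B) (x : B) : x ∈ Cs H x := by simp [mem_Cs]

lemma Cs_eq {H : Subgroup B} {x y : B} (h : y ∈ Cs H x) : Cs H y = Cs H x := by
  ext z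
  rw [mem_Cs] at *
  rw [mem_Cs]
  constructor
  · intro h1
    have := H.mul_mem h1 h
    simpa using this
  · intro h1
    have := H.mul_mem h1 (H.inv_mem h)
    simpa [mul_assoc] using this

lemma Cs_inv {H : Subgroup B} (hM : M.Normal) (hle : M ≤ H) (x : B) :
    ∀ y ∈ Cs H x, ∀ m ∈ M, y * m ∈ Cs H x := by
  intro y hy m hm
  have := H.mul_mem (hle (hM.conj_mem _ hm y)) hy
  rw [mem_Cs]
  simpa [mul_assoc] using this

lemma sg_Cs_sh {H : Subgroup B} {c : B} (hc : ∀ h, c * h * c⁻¹ ∈ H ↔ h ∈ H) (x : B) (w : B →₀ A) :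
    sg (Cs H x) (sh c w) = sg (Cs H (c⁻¹ * x)) w := by
  rw [sg_sh]
  refine sg_congr fun y _ => ?_
  rw [Set.mem_ofPred_eq, mem_Cs, mem_Cs, ← hc (y * (c⁻¹ * x)⁻¹)]
  simp [mul_assoc]

lemma sg_Cs_mem {H : Subgroup B} {c : B} (hc : c ∈ H) (x : B) (w : B →₀ A) :
    sg (Cs H x) (sh c w) = sg (Cs H x) w := by
  rw [sg_sh]
  refine sg_congr fun y _ => ?_
  rw [Set.mem_ofPred_eq, mem_Cs, mem_Cs, mul_assoc]
  exact H.mul_mem_cancel_left hc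

lemma sg_Cs_good {Z H : Subgroup B} (hZ : Z ≤ H) {w : B →₀ A}
    (hs : ∀ x ∈ w.support, ∀ y ∈ w.support, x * y⁻¹ ∈ H → x * y⁻¹ ∈ Z) {x : B} (hx : x ∈ w.support) :
    sg (Cs H x) w = sg (Cs Z x) w :=
  sg_congr fun y hy => ⟨fun h => hs y hy x hx h, fun h => hZ h⟩

lemma sg_Cs_zero {Z H : Subgroup B} (hZ : Z ≤ H) {w : B →₀ A}
    (hs : ∀ x ∈ w.support, ∀ y ∈ w.support, x * y⁻¹ ∈ H → x * y⁻¹ ∈ Z)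
    (h : ∀ x, ofAdd (sg (Cs H x) w) ∈ N) (h0 : ∀ x, ofAdd (sg (Cs Z x) w) ∈ N → sg (Cs Z x) w = 0)
    (x : B) : sg (Cs Z x) w = 0 := by
  by_contra hne
  obtain ⟨y, hy, hyx⟩ := exists_of_sg_ne hne
  rw [← Cs_eq hyx] at hne
  apply hne
  apply h0
  rw [← sg_Cs_good hZ hs hy]
  exact h y

lemma sg_Cs_zero' {Z H : Subgroup B} (hZ : Z ≤ H) {w : B →₀ A}
    (hs : ∀ x ∈ w.support, ∀ y ∈ w.support, x * y⁻¹ ∈ H → x * y⁻¹ ∈ Z)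
    (h : ∀ x, sg (Cs Z x) w = 0) (x : B) : sg (Cs H x) w = 0 := by
  by_contra hne
  obtain ⟨y, hy, hyx⟩ := exists_of_sg_ne hne
  rw [← Cs_eq hyx, sg_Cs_good hZ hs hy] at hne
  exact hne (h y)

lemma finite_range_sg (Z : Subgroup B) (w : B →₀ A) : (Set.range fun x => sg (Cs Z x) w).Finite := by
  classical
  refine Set.Finite.subset (s := insert 0 ((fun x => sg (Cs Z x) w) '' (w.support : Set B)))
    ((w.support.finite_toSet.image _).insert 0) ?_
  rintro _ ⟨x, rfl⟩
  by_cases h : sg (Cs Z x) w = 0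
  · left; exact h
  · obtain ⟨y, hy, hyx⟩ := exists_of_sg_ne h
    right
    refine ⟨y, hy, ?_⟩
    simp only [Cs_eq hyx]

lemma mem_sup_normal {Z M : Subgroup B} (hM : M.Normal) {g : B} :
    g ∈ Z ⊔ M ↔ ∃ z ∈ Z, ∃ m ∈ M, z * m = g := by
  rw [← SetLike.mem_coe, Subgroup.mul_normal, Set.mem_mul]
  rfl

lemma conj_zpowers {b c z : B} (hc : c * b = b * c) (hz : z ∈ Subgroup.zpowers b) : c * z * c⁻¹ = z := by
  obtain ⟨i, rfl⟩ := Subgroup.mem_zpowers_iff.1 hz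
  have : Commute c (b ^ i) := Commute.zpow_right hc i
  rw [this.eq]; simp

lemma conj_iff_Z {b c : B} (hc : c * b = b * c) (h : B) :
    c * h * c⁻¹ ∈ Subgroup.zpowers b ↔ h ∈ Subgroup.zpowers b := by
  have hc' : c⁻¹ * b = b * c⁻¹ := (Commute.inv_left (show Commute c b from hc)).eq
  constructor
  · intro hh
    have := conj_zpowers hc' hh
    have h2 : h = c * h * c⁻¹ := by rw [← this]; group
    rw [h2]; exact hh
  · intro hh
    rw [conj_zpowers hc hh]; exact hh

lemma conj_iff {b c : B} (hM : M.Normal) (hc : c * b = b * c) (h : B) :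
    c * h * c⁻¹ ∈ Subgroup.zpowers b ⊔ M ↔ h ∈ Subgroup.zpowers b ⊔ M := by
  have key : ∀ c h : B, c * b = b * c → h ∈ Subgroup.zpowers b ⊔ M →
      c * h * c⁻¹ ∈ Subgroup.zpowers b ⊔ M := by
    intro c h hc hh
    obtain ⟨z, hz, m, hm, rfl⟩ := (mem_sup_normal hM).1 hh
    refine (mem_sup_normal hM).2 ⟨z, hz, c * m * c⁻¹, hM.conj_mem _ hm c, ?_⟩
    conv_lhs => rw [← conj_zpowers hc hz]
    group
  refine ⟨fun hh => ?_, key c h hc⟩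
  have := key c⁻¹ _ (Commute.inv_left (show Commute c b from hc)).eq hh
  simpa [mul_assoc] using this

variable {V : ECPseudoVariety.{u}}

lemma sup_sep (hV : V.NE) (hcyc : V.CyclicSep B) (b g : B) : ∃ M ∈ V.coC B,
    (g ∈ Subgroup.zpowers b ⊔ M → g ∈ Subgroup.zpowers b) := by
  by_cases hg : g ∈ Subgroup.zpowers b
  · exact ⟨⊤, top_coC hV B, fun _ => hg⟩
  · obtain ⟨M, hM, hh⟩ := csep_iff.1 (hcyc b) g hg
    refine ⟨M, hM, fun h => ?_⟩
    obtain ⟨z, hz, m, hm, rfl⟩ := (mem_sup_normal hM.1).1 h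
    exact (hh z hz (by simpa using hm)).elim

end LWx

namespace LWx
open Multiplicative ECPseudoVariety
variable {A B : Type u} [AddCommGroup A] [Group B]
variable {N N' : Subgroup (Multiplicative A)} {M M' : Subgroup B}
variable {V : ECPseudoVariety.{u}}

lemma stepB {N0 N1 : Subgroup (Multiplicative A)} {M2 : Subgroup B} (hN : N1 ≤ N0) (hM2 : M2 ∈ V.coC B)
    (hle : M2 ≤ M) (b : B)
    (hord : ∀ n, b ^ n ∈ M2 → ∀ (x : B) (a : A), ∃ u', sh b u' = u' ∧ gsum b n x a - u' ∈ LL N0 M)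
    (s l : B →₀ A) (hl : l ∈ LL N0 M) (hs : ∀ x, sg (Cs (Subgroup.zpowers b) x) s = 0)
    (hc : s - (l - sh b l) ∈ LL N1 M2) : ∃ l' ∈ LL N0 M, s = l' - sh b l' := by
  obtain ⟨v, rfl⟩ := exists_of_coset_zero b s hs
  have hM2n := hM2.1
  have : Finite (B ⧸ M2) := V.finite _ hM2.2
  let T : AddSubgroup (B →₀ A) :=
    { carrier := {u | ∃ u', sh b u' = u' ∧ u - u' ∈ LL N0 M}
      zero_mem' := ⟨0, by simp, by simp⟩
      add_mem' := by
        rintro u w ⟨u', h1, h2⟩ ⟨w', h3, h4⟩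
        refine ⟨u' + w', by rw [map_add, h1, h3], ?_⟩
        rw [add_sub_add_comm]
        exact (LL N0 M).add_mem h2 h4
      neg_mem' := by
        rintro u ⟨u', h1, h2⟩
        refine ⟨-u', by rw [map_neg, h1], ?_⟩
        have := (LL N0 M).neg_mem h2
        convert this using 1
        abel }
  have hT : LL N1 M2 ≤ T := fun u hu => ⟨0, by simp, by simpa using LL_mono hN hle hu⟩
  have hb : b ^ orderOf (QuotientGroup.mk b : B ⧸ M2) ∈ M2 := by
    rw [← QuotientGroup.eq_one_iff, QuotientGroup.mk_pow, pow_orderOf_eq_one]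
  obtain ⟨u', h1, h2⟩ := reduce hM2n b T hT (fun x a => hord _ hb x a) (v - l) (by
    rw [map_sub]
    convert hc using 1
    abel)
  refine ⟨v - u', ?_, ?_⟩
  · have := (LL N0 M).add_mem h2 hl
    convert this using 1
    abel
  · rw [map_sub, h1]; abel

lemma claimT (hV : V.NE) (hres : V.Residually (Multiplicative A)) (hcyc : V.CyclicSep B)
    {N0 : Subgroup (Multiplicative A)} (hN0 : N0 ∈ V.coC (Multiplicative A)) (hM : M ∈ V.coC B)
    (b : B) (f t : B →₀ A) :
    ∃ N1 ∈ V.coC (Multiplicative A), N1 ≤ N0 ∧ ∃ M2 ∈ V.coC B, M2 ≤ M ∧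
      ∀ c ∈ M, c * b = b * c → ∀ l ∈ LL N0 M, t - (l + sh c f - sh b l) ∈ LL N1 M2 →
        ∃ c' ∈ M, c' * b = b * c' ∧ ∃ l' ∈ LL N0 M, t = l' + sh c' f - sh b l' := by
  classical
  set Z := Subgroup.zpowers b with hZ
  -- choice of N1
  obtain ⟨N1, hN1, hN10, hP1⟩ := avoid (V := V)
    ((Set.range fun x => sg (Cs Z x) t) - (Set.range fun x => sg (Cs Z x) f) ∪
      (Set.range fun x => sg (Cs Z x) t) ∪ (Set.range fun x => sg (Cs Z x) f))
    ((((finite_range_sg Z t).sub (finite_range_sg Z f)).union (finite_range_sg Z t)).union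
      (finite_range_sg Z f))
    (fun a K => ofAdd a ∈ K → a = 0) (fun i K K' hK h hh => h (hK hh)) (fun a _ => by
      by_cases ha : a = 0
      · exact ⟨⊤, top_coC hV _, fun _ => ha⟩
      · obtain ⟨K, hK, hh⟩ := hres (ofAdd a) (by simpa using ha)
        exact ⟨K, hK, fun h => (hh h).elim⟩) hN0
  -- choice of M2
  obtain ⟨Mo, hMo, hMoM, hord⟩ := ord hcyc hN0 hM b
  set E : Set B := (f.support : Set B) ∪ (t.support : Set B) with hE
  have hEf : E.Finite := f.support.finite_toSet.union t.support.finite_toSet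
  obtain ⟨Ma, hMa, hMao, hPa⟩ := avoid (V := V) (E * E⁻¹ ∪ (E * E⁻¹) * (E * E⁻¹))
    ((hEf.mul hEf.inv).union ((hEf.mul hEf.inv).mul (hEf.mul hEf.inv)))
    (fun g K => g ∈ Z ⊔ K → g ∈ Z) (fun i K K' hK h hh => h (sup_le_sup_left hK _ hh))
    (fun g _ => sup_sep hV hcyc b g) hMo
  obtain ⟨M2, hM2, hM2a, hPb⟩ := avoid (V := V) (E * E⁻¹) (hEf.mul hEf.inv)
    (fun y K => y * b * y⁻¹ * b⁻¹ ∈ K → y * b * y⁻¹ * b⁻¹ = 1) (fun i K K' hK h hh => h (hK hh))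
    (fun y _ => by
      by_cases hy : y * b * y⁻¹ * b⁻¹ = 1
      · exact ⟨⊤, top_coC hV _, fun _ => hy⟩
      · obtain ⟨K, hK, hh⟩ := residually_of_cyc hcyc _ hy
        exact ⟨K, hK, fun h => (hh h).elim⟩) hMa
  have hM2o : M2 ≤ Mo := hM2a.trans hMao
  have hM2M : M2 ≤ M := hM2o.trans hMoM
  refine ⟨N1, hN1, hN10, M2, hM2, hM2M, ?_⟩
  intro c hcM hcb l hl hcong
  have hM2n := hM2.1
  set H := Z ⊔ M2 with hH
  have hZH : Z ≤ H := le_sup_left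
  have hMH : M2 ≤ H := le_sup_right
  have hbZ : b ∈ Z := Subgroup.mem_zpowers b
  have hsep1 : ∀ x ∈ E, ∀ y ∈ E, x * y⁻¹ ∈ H → x * y⁻¹ ∈ Z := by
    intro x hx y hy h
    exact hPa _ (Or.inl (Set.mul_mem_mul hx (Set.inv_mem_inv.2 hy))) (sup_le_sup_left hM2a _ h)
  have hsep2 : ∀ x ∈ E, ∀ y ∈ E, ∀ x' ∈ E, ∀ y' ∈ E, (x * y⁻¹) * (x' * y'⁻¹) ∈ H →
      (x * y⁻¹) * (x' * y'⁻¹) ∈ Z := by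
    intro x hx y hy x' hx' y' hy' h
    exact hPa _ (Or.inr (Set.mul_mem_mul (Set.mul_mem_mul hx (Set.inv_mem_inv.2 hy))
      (Set.mul_mem_mul hx' (Set.inv_mem_inv.2 hy')))) (sup_le_sup_left hM2a _ h)
  have hfE : ∀ x ∈ f.support, x ∈ E := fun x hx => Or.inl hx
  have htE : ∀ x ∈ t.support, x ∈ E := fun x hx => Or.inr hx
  have hsf : ∀ x ∈ f.support, ∀ y ∈ f.support, x * y⁻¹ ∈ H → x * y⁻¹ ∈ Z :=
    fun x hx y hy => hsep1 x (hfE x hx) y (hfE y hy)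
  have hst : ∀ x ∈ t.support, ∀ y ∈ t.support, x * y⁻¹ ∈ H → x * y⁻¹ ∈ Z :=
    fun x hx y hy => hsep1 x (htE x hx) y (htE y hy)
  have H1 : ∀ c' : B, t - (l + sh c' f - sh b l) ∈ LL N1 M2 →
      ∀ x, ofAdd (sg (Cs H x) t - sg (Cs H x) (sh c' f)) ∈ N1 := by
    intro c' h x
    have := h _ (Cs_inv hM2n hMH x)
    rw [map_sub, map_sub (sg (Cs H x)) (l + _), map_add, sg_Cs_mem (hZH hbZ)] at this
    convert this using 2
    abel
  have fin : ∀ c' ∈ M, c' * b = b * c' → t - (l + sh c' f - sh b l) ∈ LL N1 M2 →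
      (∀ x, sg (Cs Z x) (t - sh c' f) = 0) →
      ∃ c' ∈ M, c' * b = b * c' ∧ ∃ l' ∈ LL N0 M, t = l' + sh c' f - sh b l' := by
    intro c' hc' hcb' h h0
    refine ⟨c', hc', hcb', ?_⟩
    obtain ⟨l', hl', he⟩ := stepB hN10 hM2 hM2M b (hord M2 hM2o) (t - sh c' f) l hl h0 (by
      convert h using 1
      abel)
    refine ⟨l', hl', ?_⟩
    rw [sub_eq_iff_eq_add] at he
    rw [he]; abel
  by_cases hcase : ∀ x, sg (Cs Z x) f = 0
  · refine fin c hcM hcb hcong fun x => ?_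
    have h1 : ∀ x, sg (Cs Z x) t = 0 := by
      refine sg_Cs_zero (N := N1) hZH hst ?_ ?_
      · intro x
        have := H1 c hcong x
        rwa [sg_Cs_sh (conj_iff hM2n hcb), sg_Cs_zero' hZH hsf hcase, sub_zero] at this
      · intro x
        exact hP1 _ (Or.inl (Or.inr ⟨x, rfl⟩))
    rw [map_sub, h1, sg_Cs_sh (conj_iff_Z hcb), hcase, sub_zero]
  · push Not at hcase
    obtain ⟨x1, hx1⟩ := hcase
    obtain ⟨x0, hx0, hx01⟩ := exists_of_sg_ne hx1
    rw [← Cs_eq hx01] at hx1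
    have h1 : ofAdd (sg (Cs H x0) f) ∉ N1 := by
      rw [sg_Cs_good hZH hsf hx0]
      exact fun h => hx1 (hP1 _ (Or.inr ⟨x0, rfl⟩) h)
    have h2 := H1 c hcong (c * x0)
    rw [sg_Cs_sh (conj_iff hM2n hcb), inv_mul_cancel_left] at h2
    have h3 : sg (Cs H (c * x0)) t ≠ 0 := by
      intro h
      rw [h, zero_sub, ofAdd_neg] at h2
      exact h1 (N1.inv_mem_iff.1 h2)
    obtain ⟨y0, hy0, hy0c⟩ := exists_of_sg_ne h3
    rw [mem_Cs] at hy0c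
    obtain ⟨z, hz, m, hm, hzm⟩ := (mem_sup_normal hM2n).1 hy0c
    -- y0 x0⁻¹ c⁻¹ = z m
    set q := y0 * x0⁻¹ with hq
    have hqe : q = z * m * c := by rw [hzm, hq]; group
    have hzb : z * b = b * z := by
      have := conj_zpowers (c := b) rfl hz
      exact (mul_inv_eq_iff_eq_mul.1 this).symm
    have hqb : q * b = b * q := by
      have : q * b * q⁻¹ * b⁻¹ = 1 := by
        refine hPb q (Set.mul_mem_mul (htE _ hy0) (Set.inv_mem_inv.2 (hfE _ hx0))) ?_
        have h5 : q * b * q⁻¹ * b⁻¹ = z * (m * (b * m⁻¹ * b⁻¹)) * z⁻¹ := by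
          have e1 : z⁻¹ * b⁻¹ = b⁻¹ * z⁻¹ := by rw [← mul_inv_rev, ← mul_inv_rev, hzb]
          have e2 : c * b * c⁻¹ = b := mul_inv_eq_iff_eq_mul.2 hcb
          calc q * b * q⁻¹ * b⁻¹ = z * m * (c * b * c⁻¹) * m⁻¹ * (z⁻¹ * b⁻¹) := by rw [hqe]; group
            _ = _ := by rw [e1, e2]; group
        rw [h5]
        exact hM2n.conj_mem _ (M2.mul_mem hm (hM2n.conj_mem _ (M2.inv_mem hm) b)) z
      rw [mul_inv_eq_one] at this
      exact mul_inv_eq_iff_eq_mul.1 this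
    set c' := z⁻¹ * q with hc'
    have hc'e : c' = m * c := by rw [hc', hqe]; group
    have hc'b : c' * b = b * c' :=
      (Commute.mul_left (Commute.inv_left (show Commute z b from hzb)) (show Commute q b from hqb)).eq
    have hc'M : c' ∈ M := by rw [hc'e]; exact M.mul_mem (hM2M hm) hcM
    have hcong' : t - (l + sh c' f - sh b l) ∈ LL N1 M2 := by
      have := (LL N1 M2).sub_mem hcong (sh_sub_mem hM2n hm (sh c f))
      rw [sh_sh, ← hc'e] at this
      convert this using 1
      abel
    refine fin c' hc'M hc'b hcong' ?_
    have hsup : ∀ x ∈ (t - sh c' f).support, x ∈ t.support ∨ ∃ y ∈ f.support, x = c' * y := by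
      intro x hx
      by_contra hc
      push Not at hc
      rw [Finsupp.mem_support_iff, Finsupp.sub_apply, sh_apply] at hx
      apply hx
      rw [Finsupp.notMem_support_iff.1 hc.1, zero_sub, neg_eq_zero]
      by_contra h
      exact hc.2 _ (Finsupp.mem_support_iff.2 h) (by group)
    have hmix : ∀ x ∈ t.support, ∀ y ∈ f.support, x * (c' * y)⁻¹ ∈ H → x * (c' * y)⁻¹ ∈ Z := by
      intro x hx y hy h
      have he : x * (c' * y)⁻¹ = (x * y⁻¹) * (x0 * y0⁻¹) * z := by
        rw [hc', hq]; group
      rw [he] at h ⊢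
      rw [H.mul_mem_cancel_right (hZH hz)] at h
      exact Z.mul_mem (hsep2 _ (htE x hx) _ (hfE y hy) _ (hfE _ hx0) _ (htE _ hy0) h) hz
    refine sg_Cs_zero (N := N1) hZH ?_ ?_ ?_
    · intro x hx y hy h
      rcases hsup x hx with hx' | ⟨x, hx', rfl⟩ <;> rcases hsup y hy with hy' | ⟨y, hy', rfl⟩
      · exact hst x hx' y hy' h
      · exact hmix x hx' y hy' h
      · rw [← inv_mem_iff] at h ⊢
        rw [mul_inv_rev, inv_inv] at h ⊢
        exact hmix y hy' x hx' h
      · have he : c' * x * (c' * y)⁻¹ = c' * (x * y⁻¹) * c'⁻¹ := by group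
        rw [he] at h ⊢
        rw [conj_iff_Z hc'b]
        rw [conj_iff hM2n hc'b] at h
        exact hsf x hx' y hy' h
    · intro x
      rw [map_sub]
      exact H1 c' hcong' x
    · intro x
      rw [map_sub, sg_Cs_sh (conj_iff_Z hc'b)]
      exact hP1 _ (Or.inl (Or.inl (Set.sub_mem_sub ⟨x, rfl⟩ ⟨_, rfl⟩)))

end LWx

namespace LW
open LWx Multiplicative ECPseudoVariety
variable {A B : Type u} [AddCommGroup A] [Group B] {V : ECPseudoVariety.{u}}

lemma core (hV : V.NE) (hres : V.Residually (Multiplicative A)) (hB : V.HCS B) (hcyc : V.CyclicSep B)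
    {N0 : Subgroup (Multiplicative A)} {M : Subgroup B}
    (hN0 : N0 ∈ V.coC (Multiplicative A)) (hM : M ∈ V.coC B) (g x : LW A B) (hx : x.r = g.r)
    (hxc : x ∉ cl g (KK N0 M)) :
    ∃ N ∈ V.coC (LW A B), ∀ k ∈ KK N0 M, (k * g * k⁻¹)⁻¹ * x ∉ N := by
  obtain ⟨N1, hN1, hN10, M2, hM2, hM2M, hcl⟩ := claimT hV hres hcyc hN0 hM g.r g.l x.l
  obtain ⟨M1, hM1, hM12, hCC⟩ := CC hB g.r hM2 hM2M
  refine ⟨KK N1 M1, KK_coC hN1 hM1, ?_⟩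
  intro k hk hkN
  obtain ⟨h1, h2⟩ := mem_KK.1 hkN
  rw [mul_r, inv_r, mul_r, mul_r, inv_r, hx] at h1
  have h1' := h1
  set d := k.r * g.r * k.r⁻¹ with hd
  have hMn := hM2.1
  have h3 : x.l - (k * g * k⁻¹).l ∈ LL N1 M2 := by
    have := LL_mono (le_refl N1) hM12 (sh_mem d h2)
    have hr : (k * g * k⁻¹).r = d := by simp [hd]
    rw [mul_l, inv_l, inv_r, hr, map_add, map_neg, sh_sh, sh_sh, mul_inv_cancel, sh_one, sh_one] at this
    convert this using 1
    abel
  rw [conj_l, ← hd] at h3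
  obtain ⟨c, hcM, hcb, hc2⟩ := hCC k.r hk.1 h1
  have hdb : d * g.r⁻¹ ∈ M2 := by
    have := hMn.conj_mem _ (M2.inv_mem (hM12 h1)) d
    simpa [mul_assoc] using this
  have h4 := sh_sub_mem (N := N1) hMn hc2 (sh c g.l)
  have h5 := sh_sub_mem (N := N1) hMn hdb (sh g.r k.l)
  rw [sh_sh, inv_mul_cancel_right] at h4 h5
  obtain ⟨c', hc'M, hc'b, l', hl', he⟩ := hcl c hcM hcb k.l hk.2 (by
    have := (LL N1 M2).sub_mem ((LL N1 M2).add_mem h3 h4) h5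
    convert this using 1
    abel)
  apply hxc
  refine ⟨⟨l', c'⟩, ⟨hc'M, hl'⟩, ?_⟩
  have hcb' : c' * g.r * c'⁻¹ = g.r := mul_inv_eq_iff_eq_mul.2 hc'b
  apply LW.ext
  · rw [conj_l, he]
    simp only [hcb']
  · simp [hcb', hx]

lemma HCS_LW (hV : V.NE) (hres : V.Residually (Multiplicative A)) (hB : V.HCS B)
    (hcyc : V.CyclicSep B) : V.HCS (LW A B) := by
  refine HCS_of_cl hV fun K hK => ?_
  obtain ⟨N0, hN0, M, hM, hle⟩ := KK_cofinal K hK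
  refine ⟨KK N0 M, KK_coC hN0 hM, hle, fun g => ?_⟩
  rw [csep_iff]
  intro x hx
  by_cases hr : x.r ∈ cl g.r M
  · obtain ⟨m, hm, hxm⟩ := hr
    set s : LW A B := inr m with hs
    have hsK : s ∈ KK N0 M := ⟨hm, (LL N0 M).zero_mem⟩
    obtain ⟨N, hN, hh⟩ := core hV hres hB hcyc hN0 hM g (s⁻¹ * x * s)
      (by simp [hs, inr_r, hxm, mul_assoc]) (by
        rintro ⟨k, hk, he⟩
        refine hx ⟨s * k, (KK N0 M).mul_mem hsK hk, ?_⟩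
        have : x = s * (s⁻¹ * x * s) * s⁻¹ := by group
        rw [this, he]; group)
    refine ⟨N, hN, ?_⟩
    rintro _ ⟨k, hk, rfl⟩ hkN
    refine hh (s⁻¹ * k) ((KK N0 M).mul_mem ((KK N0 M).inv_mem hsK) hk) ?_
    have := hN.1.conj_mem _ hkN s⁻¹
    convert this using 1
    group
  · obtain ⟨N, hN, hh⟩ := csep_iff.1 (cl_closed_of_HCS hB hM g.r) x.r hr
    refine ⟨_, coC_comap rHom hN, ?_⟩
    rintro _ ⟨k, hk, rfl⟩ hkN
    exact hh _ ⟨k.r, hk.1, rfl⟩ hkN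

lemma cyc_of_HCS [Nontrivial A] (h : V.HCS (LW A B)) : V.CyclicSep B := by
  intro b
  rw [csep_iff]
  intro c hc
  obtain ⟨a, ha⟩ := exists_ne (0 : A)
  obtain ⟨N, hN, hh⟩ := csep_iff.1 (h.1 ⟨0, b⟩)
    ⟨Finsupp.single 1 a - Finsupp.single c a, b⟩ (by
      intro hconj
      obtain ⟨k, hk⟩ := isConj_iff.1 hconj
      have h1 := congrArg LW.l hk
      have h2 : k.r * b * k.r⁻¹ = b := congrArg LW.r hk
      rw [conj_l] at h1
      simp only [h2, map_zero, add_zero] at h1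
      have h3 := congrArg (sg (Cs (Subgroup.zpowers b) 1)) h1
      rw [map_sub, sg_Cs_mem (Subgroup.mem_zpowers b), sub_self, map_sub, sg_single, sg_single,
        if_pos (Cs_self _ _), if_neg (by rw [mem_Cs]; simpa using hc), sub_zero] at h3
      exact ha h3.symm)
  refine ⟨_, coC_comap inr hN, ?_⟩
  intro x hx hxN
  obtain ⟨k, rfl⟩ := Subgroup.mem_zpowers_iff.1 hx
  obtain ⟨v, hv⟩ := exists_telescope b 1 a k
  rw [mul_one] at hv
  have hNn := hN.1
  set m := (b ^ k)⁻¹ * c with hm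
  have hcm : c = b ^ k * m := by rw [hm]; group
  have hm1 : (inr m : LW A B) ∈ N := hxN
  refine hh ⟨Finsupp.single 1 a - Finsupp.single (b ^ k) a, b⟩ ?_ ?_
  · refine isConj_iff.2 ⟨⟨v, 1⟩, ?_⟩
    apply LW.ext
    · rw [conj_l, hv]; simp
    · simp
  · have hm' : (inr (b ^ k * m * (b ^ k)⁻¹) : LW A B) ∈ N := by
      have := hNn.conj_mem _ hm1 (inr (b ^ k))
      simpa using this
    have h2 := N.mul_mem (hNn.conj_mem _ hm' ⟨Finsupp.single (b ^ k) a, 1⟩) (N.inv_mem hm')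
    have h3 := hNn.conj_mem _ h2 (⟨0, b⟩⁻¹)
    convert h3 using 1
    apply LW.ext
    · simp [inr, sub_eq_add_neg, hcm, mul_assoc]
      try abel
    · simp [inr]

end LW

lemma wr_i_of {V : ECPseudoVariety.{u}} {A B : Type u} [Group A] [Group B]
    (hA : V.HCS A) (hB : V.mem B) : V.HCS (RWreath A B) := by
  have : Finite B := V.finite _ hB
  exact ECPseudoVariety.HCS_equiv ⟨B, _, hB⟩ PW.equiv.symm (PW.HCS_of hB hA)

lemma NE_of_res {V : ECPseudoVariety.{u}} {A : Type u} [Group A] [Nontrivial A]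
    (h : V.Residually A) : V.NE := by
  obtain ⟨a, ha⟩ := exists_ne (1 : A)
  obtain ⟨N, hN, _⟩ := h a ha
  exact ECPseudoVariety.NE_of_coC hN

lemma wr_ii_of {V : ECPseudoVariety.{u}} {A B : Type u} [CommGroup A] [Group B] [Nontrivial A]
    (hA : V.Residually A) (hB : V.HCS B) (hc : V.CyclicSep B) : V.HCS (RWreath A B) := by
  have hV := NE_of_res hA
  refine ECPseudoVariety.HCS_equiv hV LW.equiv.symm (LW.HCS_LW hV ?_ hB hc)
  exact ECPseudoVariety.residually_of_inj (MulEquiv.multiplicativeAdditive A).toMonoidHom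
    (MulEquiv.multiplicativeAdditive A).injective hA

lemma wr_cyc {V : ECPseudoVariety.{u}} {A B : Type u} [CommGroup A] [Group B] [Nontrivial A]
    (hV : V.NE) (h : V.HCS (RWreath A B)) : V.CyclicSep B :=
  LW.cyc_of_HCS (A := Additive A) (ECPseudoVariety.HCS_equiv hV LW.equiv h)

open Classical in
noncomputable def dl {A B : Type u} [Group A] (x : B) : A →* WreathBase A B where
  toFun a := ⟨Pi.mulSingle x a, (Set.finite_singleton x).subset Pi.mulSupport_mulSingle_subset⟩
  map_one' := Subtype.ext (Pi.mulSingle_one x)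
  map_mul' a b := Subtype.ext (Pi.mulSingle_mul (f := fun _ => A) x a b)

lemma dl_inj {A B : Type u} [Group A] (x : B) : Function.Injective (dl x : A →* WreathBase A B) := by
  intro a a' h
  have := congrFun (congrArg Subtype.val h) x
  simpa [dl] using this

lemma dl_comm {A B : Type u} [Group A] {x y : B} (h : x ≠ y) (a a' : A) :
    Commute (dl x a : WreathBase A B) (dl y a') := by
  classical
  apply Subtype.ext
  exact (Pi.mulSingle_commute (f := fun _ => A) h a a').eq

lemma dl_shift {A B : Type u} [Group A] [Group B] (b : B) (a : A) :
    wreathAction A B b (dl 1 a) = dl b a := by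
  classical
  apply Subtype.ext
  funext x
  change (Pi.mulSingle (M := fun _ : B => A) 1 a) (b⁻¹ * x) = (Pi.mulSingle (M := fun _ : B => A) b a) x
  by_cases hx : x = b
  · subst hx; simp
  · rw [Pi.mulSingle_eq_of_ne hx, Pi.mulSingle_eq_of_ne]
    intro h
    apply hx
    rw [inv_mul_eq_one] at h
    exact h.symm

open ECPseudoVariety in
lemma wr_nonab {V : ECPseudoVariety.{u}} {A B : Type u} [Group A] [Group B]
    (h : V.Residually (RWreath A B)) (a a' : A) (hne : a * a' ≠ a' * a) : V.mem B := by
  let i : A →* RWreath A B := SemidirectProduct.inl.comp (dl 1)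
  have hi : Function.Injective i := SemidirectProduct.inl_injective.comp (dl_inj 1)
  obtain ⟨N, hN, hh⟩ := h (i a * i a' * (i a)⁻¹ * (i a')⁻¹) (by
    intro he
    apply hne
    apply hi
    rw [map_mul, map_mul]
    rw [mul_inv_eq_one, mul_inv_eq_iff_eq_mul] at he
    exact he)
  have hNn := hN.1
  have hbot : N.comap (SemidirectProduct.inr : B →* RWreath A B) = ⊥ := by
    rw [eq_bot_iff]
    intro b hb
    by_contra hb1
    apply hh
    have hb' : (SemidirectProduct.inr b : RWreath A B) ∈ N := hb
    have h1 : (SemidirectProduct.inr b : RWreath A B) * i a' * (SemidirectProduct.inr b)⁻¹ =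
        SemidirectProduct.inl (dl b a') := by
      rw [← dl_shift, SemidirectProduct.inl_aut, map_inv]
      rfl
    have h2 : Commute (i a) (SemidirectProduct.inl (dl b a') : RWreath A B) :=
      (dl_comm (fun h => hb1 (by rw [← h]; exact Subgroup.one_mem _)) a a').map SemidirectProduct.inl
    rw [← h1] at h2
    rw [← QuotientGroup.eq_one_iff] at hb' ⊢
    have h3 := h2.map (QuotientGroup.mk' N)
    simp only [map_mul, map_inv, QuotientGroup.mk'_apply, hb', one_mul, inv_one, mul_one] at h3
    simp only [QuotientGroup.mk_mul, QuotientGroup.mk_inv]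
    rw [h3.eq]; simp
  have := coC_comap (SemidirectProduct.inr : B →* RWreath A B) hN
  rw [hbot] at this
  exact mem_of_bot this


/-- `A ≀ B` is `𝒞`-hereditarily conjugacy separable iff either `A` is
`𝒞`-HCS and `B ∈ 𝒞`, or `A` is abelian and residually-`𝒞`, and `B` is `𝒞`-HCS with all
cyclic subgroups `𝒞`-separable. -/
theorem wreath_CHCS_iff (V : ECPseudoVariety.{u}) (A B : Type u) [Group A] [Group B]
    [Nontrivial A] :
    V.HCS (RWreath A B) ↔
      (V.HCS A ∧ V.mem B) ∨
      ((∀ x y : A, x * y = y * x) ∧ V.Residually A ∧ V.HCS B ∧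
        ∀ b : B, V.CSeparable ((Subgroup.zpowers b : Subgroup B) : Set B)) := by
  constructor
  · intro h
    have hres := ECPseudoVariety.residually_of_conjSep h.1
    have hinj : Function.Injective
        ((SemidirectProduct.inl : WreathBase A B →* RWreath A B).comp (dl (1 : B)) : A →* _) :=
      SemidirectProduct.inl_injective.comp (dl_inj 1)
    have hA : V.Residually A := ECPseudoVariety.residually_of_inj _ hinj hres
    have hV := NE_of_res hA
    by_cases hab : ∀ x y : A, x * y = y * x
    · refine Or.inr ⟨hab, hA, ?_, ?_⟩
      · exact ECPseudoVariety.HCS_retract hV SemidirectProduct.inr SemidirectProduct.rightHom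
          (fun _ => rfl) h
      · letI : CommGroup A := { ‹Group A› with mul_comm := hab }
        exact wr_cyc (A := A) hV h
    · push Not at hab
      obtain ⟨a, a', hne⟩ := hab
      have hB := wr_nonab hres a a' hne
      have : Finite B := V.finite _ hB
      exact Or.inl ⟨PW.HCS_base hB (ECPseudoVariety.HCS_equiv hV PW.equiv h), hB⟩
  · rintro (⟨hA, hB⟩ | ⟨hab, hA, hB, hc⟩)
    · exact wr_i_of hA hB
    · letI : CommGroup A := { ‹Group A› with mul_comm := hab }
      exact wr_ii_of (A := A) hA hB hc
end

section
/- Let 𝒞 be an extension-closed pseudo-variety of finite groups, let A be a group and let B be a group with B ∈ 𝒞. Then the restricted wreath product A ≀ B is 𝒞-hereditarily conjugacy separable if and only if A is 𝒞-hereditarily conjugacy separable. -/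
open Pointwise

universe u

namespace ECPseudoVariety

variable {V : ECPseudoVariety.{u}}

lemma ker_mem {G H : Type u} [Group G] [Group H] (φ : G →* H) (h : V.mem H) :
    φ.ker ∈ V.coC G :=
  ⟨inferInstance, V.iso_closed _ _ (QuotientGroup.quotientKerEquivRange φ).symm
    (V.subgroup_closed _ φ.range h)⟩

lemma mem_fin {Q : Type u} [Group Q] (h : V.mem Q) (n : ℕ) : V.mem (Fin n → Q) := by
  induction n with
  | zero =>
    refine mem_of_inj (1 : (Fin 0 → Q) →* Q) ?_ h
    intro a b _
    exact Subsingleton.elim _ _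
  | succ n ih =>
    refine mem_of_inj (H := Q × (Fin n → Q))
      { toFun := fun f => (f 0, fun i => f i.succ)
        map_one' := rfl
        map_mul' := fun _ _ => rfl } ?_ (V.prod_closed _ _ h ih)
    intro a b hab
    simp only [MonoidHom.coe_mk, OneHom.coe_mk, Prod.mk.injEq] at hab
    funext i
    refine Fin.cases hab.1 (fun j => congrFun hab.2 j) i

lemma mem_pi {Q ι : Type u} [Group Q] [Finite ι] (h : V.mem Q) : V.mem (ι → Q) := by
  obtain ⟨n, ⟨e⟩⟩ := Finite.exists_equiv_fin ι
  refine mem_of_inj (H := Fin n → Q)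
      { toFun := fun f => fun i => f (e.symm i)
        map_one' := rfl
        map_mul' := fun _ _ => rfl } ?_ (mem_fin h n)
  intro a b hab
  funext i
  have := congrFun hab (e i)
  simpa using this

lemma comap_mem {G H : Type u} [Group G] [Group H] (φ : G →* H) {N : Subgroup H}
    (hN : N ∈ V.coC H) : N.comap φ ∈ V.coC G := by
  obtain ⟨hn, hm⟩ := hN
  have := ker_mem ((QuotientGroup.mk' N).comp φ) hm
  rwa [← MonoidHom.comap_ker, QuotientGroup.ker_mk'] at this

lemma inf_mem {G : Type u} [Group G] {N M : Subgroup G}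
    (hN : N ∈ V.coC G) (hM : M ∈ V.coC G) : N ⊓ M ∈ V.coC G := by
  obtain ⟨hn, hm⟩ := hN
  obtain ⟨hn', hm'⟩ := hM
  have := ker_mem ((QuotientGroup.mk' N).prod (QuotientGroup.mk' M)) (V.prod_closed _ _ hm hm')
  rwa [MonoidHom.ker_prod, QuotientGroup.ker_mk', QuotientGroup.ker_mk'] at this

lemma mem_of_hom {G H : Type u} [Group G] [Group H] (φ : G →* H) (h : V.mem H)
    (hk : V.mem φ.ker) : V.mem G :=
  V.extension_closed G φ.ker hk (ker_mem φ h).2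

lemma ext_mem {G : Type u} [Group G] {K M : Subgroup G} (hK : K ∈ V.coC G) [hMn : M.Normal]
    (hMK : M ≤ K) (h : M.subgroupOf K ∈ V.coC K) : M ∈ V.coC G := by
  obtain ⟨hn, hm⟩ := hK
  refine ⟨hMn, ?_⟩
  refine mem_of_hom (QuotientGroup.map M K (MonoidHom.id G) hMK) hm ?_
  have e : (QuotientGroup.map M K (MonoidHom.id G) hMK).ker
      = ((QuotientGroup.mk' M).comp K.subtype).range := by
    ext x
    induction x using QuotientGroup.induction_on with
    | H g =>
      rw [MonoidHom.mem_ker, MonoidHom.mem_range]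
      constructor
      · intro hg
        have hg' : g ∈ K := by
          rw [← QuotientGroup.eq_one_iff]; exact hg
        exact ⟨⟨g, hg'⟩, rfl⟩
      · rintro ⟨k, hk⟩
        rw [← hk]
        exact (QuotientGroup.eq_one_iff (k : G)).2 k.2
  rw [e]
  obtain ⟨h1, h2⟩ := h
  have e2 : M.subgroupOf K = ((QuotientGroup.mk' M).comp K.subtype).ker := by
    rw [← MonoidHom.comap_ker, QuotientGroup.ker_mk']; rfl
  exact V.iso_closed _ _ ((QuotientGroup.quotientMulEquivOfEq e2).trans
    (QuotientGroup.quotientKerEquivRange _)) h2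

lemma finite_quot {G : Type u} [Group G] {K : Subgroup G} (hK : K ∈ V.coC G) :
    Finite (G ⧸ K) := by
  obtain ⟨hn, hm⟩ := hK
  exact V.finite _ hm

lemma core_mem {G : Type u} [Group G] {H : Subgroup G} (hH : V.COpen H) {N : Subgroup H}
    (hN : N ∈ V.coC H) : ∃ M ∈ V.coC G, M ≤ N.map H.subtype := by
  obtain ⟨K, hK, hKH⟩ := hH
  obtain ⟨hKn, hKm⟩ := id hK
  obtain ⟨hNn, hNm⟩ := hN
  have := finite_quot hK
  have cj : ∀ (g : G) (k : G), k ∈ K → g⁻¹ * k * g ∈ H := fun g k hk =>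
    hKH (by simpa using hKn.conj_mem k hk g⁻¹)
  let c : G → K →* H := fun g =>
    { toFun := fun k => ⟨g⁻¹ * k * g, cj g k k.2⟩
      map_one' := by ext; simp
      map_mul' := fun a b => by ext; simp; group }
  let M : Subgroup G := ⨅ g : G, (N.comap (c g)).map K.subtype
  have hM : ∀ m, m ∈ M ↔ ∃ hm : m ∈ K, ∀ g, c g ⟨m, hm⟩ ∈ N := by
    intro m
    simp only [M, Subgroup.mem_iInf, Subgroup.mem_map, Subgroup.mem_comap]
    constructor
    · intro h
      obtain ⟨k, -, rfl⟩ := h 1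
      refine ⟨k.2, fun g => ?_⟩
      obtain ⟨k', hk', he⟩ := h g
      have : k' = k := Subtype.ext he
      subst this
      exact hk'
    · rintro ⟨hm, h⟩ g
      exact ⟨⟨m, hm⟩, h g, rfl⟩
  have : M.Normal := by
    constructor
    intro m hm g
    rw [hM] at hm ⊢
    obtain ⟨h1, h2⟩ := hm
    refine ⟨hKn.conj_mem m h1 g, fun t => ?_⟩
    have := h2 (g⁻¹ * t)
    convert this using 1
    ext
    simp [c]
    group
  refine ⟨M, ext_mem hK ?_ ?_, ?_⟩
  · intro m hm
    exact ((hM m).1 hm).1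
  · have := ker_mem (V := V) (G := K) (H := (G ⧸ K) → H ⧸ N)
      { toFun := fun k q => (QuotientGroup.mk (c q.out k) : H ⧸ N)
        map_one' := by funext q; simp
        map_mul' := fun a b => by funext q; simp } (mem_pi hNm)
    convert this using 1
    ext k
    rw [Subgroup.mem_subgroupOf, hM, MonoidHom.mem_ker]
    constructor
    · rintro ⟨h1, h2⟩
      funext q
      exact (QuotientGroup.eq_one_iff _).2 (h2 q.out)
    · intro h
      refine ⟨k.2, fun g => ?_⟩
      have h1 := (QuotientGroup.eq_one_iff _).1 (congrFun h (g : G ⧸ K))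
      set r := (g : G ⧸ K).out with hr
      have h3 : r⁻¹ * g ∈ K := by
        rw [← QuotientGroup.eq, hr]; simp
      have h4 := hNn.conj_mem _ h1 ⟨r⁻¹ * g, hKH h3⟩⁻¹
      convert h4 using 1
      ext
      simp [c]
      group
  · intro m hm
    obtain ⟨h1, h2⟩ := (hM m).1 hm
    refine ⟨⟨m, hKH h1⟩, ?_, rfl⟩
    rw [SetLike.mem_coe]
    have := h2 1
    convert this using 1
    ext
    simp [c]

lemma sep_iff {G : Type u} [Group G] {X : Set G} :
    V.CSeparable X ↔ ∀ g ∉ X, ∃ N ∈ V.coC G, ∀ x ∈ X, g⁻¹ * x ∉ N := by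
  unfold CSeparable
  refine forall_congr' fun g => imp_congr_right fun _ => exists_congr fun N =>
    and_congr_right fun _ => ?_
  simp only [Set.mem_image, not_exists, not_and]
  refine forall_congr' fun x => imp_congr_right fun _ => ?_
  rw [← QuotientGroup.eq]
  exact not_congr eq_comm

lemma sep_iUnion {G ι : Type u} [Group G] [Finite ι] {X : ι → Set G} (h1 : ⊤ ∈ V.coC G)
    (h : ∀ i, V.CSeparable (X i)) : V.CSeparable (⋃ i, X i) := by
  rw [sep_iff]
  intro g hg
  simp only [Set.mem_iUnion, not_exists] at hg
  have : ∀ i, ∃ N ∈ V.coC G, ∀ x ∈ X i, g⁻¹ * x ∉ N := fun i => sep_iff.1 (h i) g (hg i)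
  choose N hN hx using this
  have key : ∀ s : Set ι, s.Finite → ∃ M ∈ V.coC G, ∀ i ∈ s, M ≤ N i := by
    intro s hs
    induction s, hs using Set.Finite.induction_on with
    | empty => exact ⟨⊤, h1, by simp⟩
    | insert _ _ ih =>
      rename_i a s _ _
      obtain ⟨M, hM, hMs⟩ := ih
      refine ⟨M ⊓ N a, inf_mem hM (hN a), ?_⟩
      intro i hi
      rcases hi with rfl | hi
      · exact inf_le_right
      · exact inf_le_left.trans (hMs i hi)
  obtain ⟨M, hM, hMs⟩ := key Set.univ Set.finite_univ
  refine ⟨M, hM, fun x hxU hxM => ?_⟩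
  obtain ⟨i, hi⟩ := Set.mem_iUnion.1 hxU
  exact hx i x hi (hMs i trivial hxM)

lemma sep_preimage {G H : Type u} [Group G] [Group H] (φ : G →* H) {X : Set H}
    (h : V.CSeparable X) : V.CSeparable (φ ⁻¹' X) := by
  rw [sep_iff] at h ⊢
  intro g hg
  obtain ⟨N, hN, hx⟩ := h (φ g) hg
  refine ⟨_, comap_mem φ hN, fun x hxX hxN => hx _ hxX ?_⟩
  simpa using hxN

/-- the `K`-conjugacy class of `g`. -/
def kcl {G : Type u} [Group G] (g : G) (K : Subgroup G) : Set G :=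
  {x | ∃ k ∈ K, k * g * k⁻¹ = x}

lemma kcl_sep_of_le {G : Type u} [Group G] {K H : Subgroup G} (hK : K ∈ V.coC G)
    (hKH : K ≤ H) (h : ∀ g, V.CSeparable (kcl g K)) (g : G) : V.CSeparable (kcl g H) := by
  obtain ⟨hKn, hKm⟩ := id hK
  have := finite_quot hK
  have htop : (⊤ : Subgroup G) ∈ V.coC G := by
    have := ker_mem (1 : G →* (G ⧸ K)) hKm
    rwa [MonoidHom.ker_one] at this
  let ι := {q : G ⧸ K // ∃ x ∈ H, (x : G ⧸ K) = q}
  choose r hr hrq using fun i : ι => i.2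
  have e : kcl g H = ⋃ i : ι, kcl (r i * g * (r i)⁻¹) K := by
    ext x
    simp only [kcl, Set.mem_ofPred_eq, Set.mem_iUnion]
    constructor
    · rintro ⟨k, hk, rfl⟩
      let i : ι := ⟨(k : G ⧸ K), k, hk, rfl⟩
      have hi : k⁻¹ * r i ∈ K := QuotientGroup.eq.1 (hrq i).symm
      refine ⟨i, k * (r i)⁻¹, ?_, by group⟩
      have := hKn.conj_mem _ (K.inv_mem hi) k
      convert this using 1
      group
    · rintro ⟨i, k, hk, rfl⟩
      exact ⟨k * r i, H.mul_mem (hKH hk) (hr i), by group⟩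
  rw [e]
  exact sep_iUnion htop fun i => h _

lemma hcs_iff {G : Type u} [Group G] (hne : ∃ K, K ∈ V.coC G) :
    V.HCS G ↔ ∀ K ∈ V.coC G, ∀ g, V.CSeparable (kcl g K) := by
  constructor
  · rintro ⟨-, h⟩ K hK g
    obtain ⟨hKn, hKm⟩ := id hK
    let F := K ⊔ Subgroup.zpowers g
    have hF : V.COpen F := ⟨K, hK, le_sup_left⟩
    have hgF : g ∈ F := (le_sup_right : Subgroup.zpowers g ≤ F) (Subgroup.mem_zpowers g)
    have h1 := sep_iff.1 (h F hF ⟨g, hgF⟩)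
    rw [sep_iff]
    intro y hy
    by_cases hyF : y ∈ F
    · obtain ⟨N, hN, hx⟩ := h1 ⟨y, hyF⟩ (by
        rw [Set.mem_ofPred_eq, isConj_iff]
        rintro ⟨⟨c, hc⟩, hce⟩
        apply hy
        obtain ⟨k, hk, z, hz, rfl⟩ := Subgroup.mem_sup_of_normal_left.1 hc
        obtain ⟨n, rfl⟩ := Subgroup.mem_zpowers_iff.1 hz
        have := congrArg Subtype.val hce
        simp only [Subgroup.coe_mul, Subgroup.coe_inv] at this
        refine ⟨k, hk, ?_⟩
        rw [← this]
        group)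
      obtain ⟨M, hM, hMN⟩ := core_mem hF hN
      refine ⟨M, hM, ?_⟩
      rintro x ⟨k, hk, rfl⟩ hxM
      have hkF : k ∈ F := (le_sup_left : K ≤ F) hk
      obtain ⟨n, hn, hne⟩ := hMN hxM
      refine hx (⟨k, hkF⟩ * ⟨g, hgF⟩ * ⟨k, hkF⟩⁻¹) (isConj_iff.2 ⟨_, rfl⟩) ?_
      rw [SetLike.mem_coe] at hn
      convert hn using 1
      ext
      rw [← Subgroup.coe_subtype, hne]
      rfl
    · refine ⟨K, hK, ?_⟩
      rintro x ⟨k, hk, rfl⟩ hxK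
      apply hyF
      have hkF : k ∈ F := (le_sup_left : K ≤ F) hk
      have h2 : y⁻¹ * (k * g * k⁻¹) ∈ F := (le_sup_left : K ≤ F) hxK
      have h3 := F.mul_mem (F.mul_mem (F.mul_mem hkF hgF) (F.inv_mem hkF)) (F.inv_mem h2)
      convert h3 using 1
      group
  · intro h
    have hop : ∀ H : Subgroup G, V.COpen H → V.ConjSep H := by
      rintro H ⟨K, hK, hKH⟩ g
      have := sep_preimage H.subtype (kcl_sep_of_le hK hKH (h K hK) (g : G))
      convert this using 1
      ext x
      rw [Set.mem_ofPred_eq, isConj_iff]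
      constructor
      · rintro ⟨c, rfl⟩
        exact ⟨c, c.2, rfl⟩
      · rintro ⟨k, hk, he⟩
        exact ⟨⟨k, hk⟩, Subtype.ext he⟩
    refine ⟨?_, hop⟩
    obtain ⟨K, hK⟩ := hne
    intro g
    have := kcl_sep_of_le hK (le_top : K ≤ ⊤) (h K hK) g
    convert this using 1
    ext x
    rw [Set.mem_ofPred_eq, isConj_iff]
    simp [kcl]

end ECPseudoVariety
section WreathProof

variable {V : ECPseudoVariety.{u}} {A B : Type u} [Group A] [Group B]

open ECPseudoVariety

lemma wr_act (c : B) (f : WreathBase A B) (x : B) :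
    ((wreathAction A B c f : WreathBase A B) : B → A) x = (f : B → A) (c⁻¹ * x) := rfl

/-- functions with values in `L`. -/
def wrSub (B : Type u) [Group B] (L : Subgroup A) : Subgroup (RWreath A B) where
  carrier := {w | w.right = 1 ∧ ∀ x, (w.left : B → A) x ∈ L}
  one_mem' := ⟨rfl, fun _ => L.one_mem⟩
  mul_mem' := by
    rintro a b ⟨ha, ha'⟩ ⟨hb, hb'⟩
    refine ⟨by simp [ha, hb], fun x => ?_⟩
    rw [SemidirectProduct.mul_left]
    exact L.mul_mem (ha' x) (hb' _)
  inv_mem' := by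
    rintro a ⟨ha, ha'⟩
    refine ⟨by simp [ha], fun x => ?_⟩
    rw [SemidirectProduct.inv_left]
    exact L.inv_mem (ha' _)

lemma mem_wrSub {L : Subgroup A} {w : RWreath A B} :
    w ∈ wrSub B L ↔ w.right = 1 ∧ ∀ x, (w.left : B → A) x ∈ L := Iff.rfl

lemma conj_left (k w : RWreath A B) (x : B) :
    ((k * w * k⁻¹).left : B → A) x =
      (k.left : B → A) x * (w.left : B → A) (k.right⁻¹ * x) *
        ((k.left : B → A) (k.right * w.right⁻¹ * k.right⁻¹ * x))⁻¹ := by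
  rw [SemidirectProduct.mul_left, SemidirectProduct.mul_left, SemidirectProduct.inv_left,
    SemidirectProduct.mul_right]
  show _ * _ * (((k.left : B → A) ((k.right⁻¹)⁻¹ * ((k.right * w.right)⁻¹ * x)))⁻¹) = _
  congr 3
  group

instance wrSub_normal (L : Subgroup A) [hL : L.Normal] : (wrSub B L).Normal := by
  constructor
  rintro w ⟨h1, h2⟩ k
  refine ⟨by simp [h1], fun x => ?_⟩
  rw [conj_left, h1]
  simpa using hL.conj_mem _ (h2 (k.right⁻¹ * x)) ((k.left : B → A) x)

lemma wrSub_mem (hB : V.mem B) {L : Subgroup A} (hL : L ∈ V.coC A) :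
    wrSub B L ∈ V.coC (RWreath A B) := by
  obtain ⟨hLn, hLm⟩ := id hL
  have := V.finite B hB
  let K : Subgroup (RWreath A B) := (SemidirectProduct.rightHom).ker
  have hK : K ∈ V.coC (RWreath A B) := ker_mem _ hB
  refine ext_mem hK (fun w hw => hw.1) ?_
  have := ker_mem (V := V) (G := K) (H := B → A ⧸ L)
      { toFun := fun k x => (QuotientGroup.mk ((k.1.left : B → A) x) : A ⧸ L)
        map_one' := rfl
        map_mul' := fun a b => by
          funext x
          have ha : a.1.right = 1 := a.2
          show QuotientGroup.mk (((a.1 * b.1).left : B → A) x) = _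
          rw [SemidirectProduct.mul_left, ha, map_one]
          rfl } (mem_pi hLm)
  convert this using 1
  ext k
  rw [Subgroup.mem_subgroupOf, MonoidHom.mem_ker]
  constructor
  · rintro ⟨h1, h2⟩
    funext x
    exact (QuotientGroup.eq_one_iff _).2 (h2 x)
  · intro h
    exact ⟨k.2, fun x => (QuotientGroup.eq_one_iff _).1 (congrFun h x)⟩

/-- coordinate embedding. -/
noncomputable def wrSingle (x : B) : A →* RWreath A B := by
  classical
  exact
  { toFun := fun a => SemidirectProduct.inl ⟨Pi.mulSingle x a, by
      show (Function.mulSupport _).Finite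
      exact (Set.finite_singleton x).subset (Pi.mulSupport_mulSingle_subset)⟩
    map_one' := by
      rw [← map_one (SemidirectProduct.inl)]
      congr 1
      ext : 1
      exact Pi.mulSingle_one x
    map_mul' := fun a b => by
      rw [← map_mul (SemidirectProduct.inl)]
      congr 1
      ext : 1
      exact Pi.mulSingle_mul (f := fun _ : B => A) x a b }

/-- diagonal embedding. -/
def wrDiag [Finite B] : A →* RWreath A B where
  toFun := fun a => SemidirectProduct.inl ⟨fun _ => a, Set.toFinite _⟩
  map_one' := rfl
  map_mul' := fun a b => by
    rw [← map_mul (SemidirectProduct.inl)]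
    rfl

lemma wrSub_cofinal (hB : V.mem B) {K : Subgroup (RWreath A B)}
    (hK : K ∈ V.coC (RWreath A B)) : ∃ L ∈ V.coC A, wrSub B L ≤ K := by
  classical
  have := V.finite B hB
  obtain ⟨hKn, hKm⟩ := id hK
  have := ker_mem (V := V) (G := A) (H := B → (RWreath A B ⧸ K))
      (MonoidHom.pi fun x => (QuotientGroup.mk' K).comp (wrSingle x)) (mem_pi hKm)
  refine ⟨_, this, ?_⟩
  intro w ⟨h1, h2⟩
  have hs : ∀ x y, wrSingle y ((w.left : B → A) x) ∈ K := by
    intro x y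
    exact (QuotientGroup.eq_one_iff _).1 (congrFun (h2 x) y)
  obtain ⟨w1, w2⟩ := w
  obtain rfl : w2 = 1 := h1
  have key : ∀ s : Set B, s.Finite → ∀ f : WreathBase A B, Function.mulSupport (f : B → A) ⊆ s →
      (∀ x y, wrSingle y ((f : B → A) x) ∈ K) →
      (SemidirectProduct.inl f : RWreath A B) ∈ K := by
    intro s hs
    induction s, hs using Set.Finite.induction_on with
    | empty =>
      intro f hf _
      have : f = 1 := by
        ext x
        by_contra hx
        exact hf (show x ∈ Function.mulSupport (f : B → A) from hx)
      rw [this, map_one]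
      exact K.one_mem
    | @insert a s has hs ih =>
      intro f hf hfK
      let g : WreathBase A B := ⟨Function.update (f : B → A) a 1, Set.toFinite _⟩
      have hg := ih g (by
        intro x hx
        by_cases hxa : x = a
        · subst hxa
          simp [g] at hx
        · simp [g, hxa] at hx
          exact (hf hx).resolve_left hxa) (by
        intro x y
        by_cases hxa : x = a
        · subst hxa
          simp [g]
        · simpa [g, hxa] using hfK x y)
      have h3 := K.mul_mem hg (hfK a a)
      convert h3 using 1
      show _ = SemidirectProduct.inl g * SemidirectProduct.inl _
      rw [← map_mul]
      congr 1
      ext x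
      show (f : B → A) x = Function.update (f : B → A) a 1 x *
        (Pi.mulSingle a ((f : B → A) a) : B → A) x
      by_cases hxa : x = a
      · subst hxa
        simp
      · simp [hxa]
  exact key Set.univ Set.finite_univ w1 (Set.subset_univ _) hs

/-- partial products along an orbit: `f(b^i x) ... f(b x)`. -/
def wrP (f : B → A) (b x : B) : ℕ → A
  | 0 => 1
  | i + 1 => f (b ^ (i + 1) * x) * wrP f b x i

lemma wrP_add (f : B → A) (b x : B) (i : ℕ) :
    wrP f b x (i + orderOf b) = wrP f b x i * wrP f b x (orderOf b) := by
  induction i with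
  | zero => simp [wrP]
  | succ i ih =>
    have : i + 1 + orderOf b = (i + orderOf b) + 1 := by omega
    rw [this, wrP, ih, wrP, mul_assoc]
    congr 3
    rw [show i + orderOf b + 1 = i + 1 + orderOf b by omega, pow_add, pow_orderOf_eq_one, mul_one]

lemma wrP_conj {f f' k : B → A} {b : B}
    (h : ∀ x, k x * f x * (k (b⁻¹ * x))⁻¹ = f' x) (x : B) (i : ℕ) :
    wrP f' b x i = k (b ^ i * x) * wrP f b x i * (k x)⁻¹ := by
  induction i with
  | zero => simp [wrP]
  | succ i ih =>
    rw [wrP, ih, wrP, ← h]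
    have : b⁻¹ * (b ^ (i + 1) * x) = b ^ i * x := by rw [pow_succ']; group
    rw [this]
    group

lemma wrP_mod {f f' : B → A} {b : B} (L : Subgroup A) [hL : L.Normal]
    (h : ∀ x, (f x)⁻¹ * f' x ∈ L) (x : B) (i : ℕ) :
    (QuotientGroup.mk (wrP f b x i) : A ⧸ L) = QuotientGroup.mk (wrP f' b x i) := by
  induction i with
  | zero => rfl
  | succ i ih =>
    rw [wrP, wrP, QuotientGroup.mk_mul, QuotientGroup.mk_mul, ih, QuotientGroup.eq.2 (h _)]

lemma exists_solution [Finite B] {f f' : B → A} {b : B} (L : Subgroup A) [hL : L.Normal]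
    (h : ∀ x, (f x)⁻¹ * f' x ∈ L)
    (hP : ∀ x, wrP f' b x (orderOf b) ∈ kcl (wrP f b x (orderOf b)) L) :
    ∃ k : B → A, (∀ x, k x ∈ L) ∧ ∀ x, k x * f x * (k (b⁻¹ * x))⁻¹ = f' x := by
  choose a haL ha using hP
  let Q : B → ℕ → A := fun r i => wrP f' b r i * a r * (wrP f b r i)⁻¹
  have hQ : ∀ r, Function.Periodic (Q r) (orderOf b) := by
    intro r i
    simp only [Q]
    rw [wrP_add, wrP_add, ← ha]
    group
  have hQ' : ∀ r i j, b ^ i * r = b ^ j * r → Q r i = Q r j := by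
    intro r i j hij
    have := pow_eq_pow_iff_modEq.1 (mul_right_cancel hij)
    rw [← (hQ r).map_mod_nat i, ← (hQ r).map_mod_nat j, this]
  -- representatives
  let S : Setoid B := QuotientGroup.rightRel (Subgroup.zpowers b)
  let r : B → B := fun x => (Quotient.mk S x).out
  have hr : ∀ x, ∃ i : ℕ, b ^ i * r x = x := by
    intro x
    have h1 : S (r x) x := Quotient.exact (Quotient.out_eq (Quotient.mk S x))
    rw [QuotientGroup.rightRel_apply] at h1
    obtain ⟨i, hi⟩ := (mem_powers_iff_mem_zpowers).2 h1
    exact ⟨i, by simp only at hi; rw [hi]; group⟩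
  have hr' : ∀ x, r (b⁻¹ * x) = r x := by
    intro x
    have : Quotient.mk S (b⁻¹ * x) = Quotient.mk S x := by
      apply Quotient.sound
      show S _ _
      rw [QuotientGroup.rightRel_apply]
      simp
    simp only [r, this]
  choose n hn using hr
  refine ⟨fun x => Q (r x) (n x), fun x => ?_, fun x => ?_⟩
  · rw [← QuotientGroup.eq_one_iff]
    simp only [Q]
    rw [QuotientGroup.mk_mul, QuotientGroup.mk_mul, QuotientGroup.mk_inv,
      (QuotientGroup.eq_one_iff _).2 (haL _), wrP_mod L h]
    simp
  · have e : Q (r x) (n x) = Q (r x) (n (b⁻¹ * x) + 1) := by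
      apply hQ'
      have := hn (b⁻¹ * x)
      rw [hr'] at this
      rw [hn, pow_succ', mul_assoc, this]
      group
    have hx : b ^ (n (b⁻¹ * x) + 1) * r x = x := by
      have := hn (b⁻¹ * x)
      rw [hr'] at this
      rw [pow_succ', mul_assoc, this]
      group
    simp only
    rw [e, hr']
    simp only [Q, wrP, hx]
    group

lemma kcl_wrSub_sep (hB : V.mem B) {L : Subgroup A} (hL : L ∈ V.coC A)
    (hA : ∀ a : A, V.CSeparable (kcl a L)) (w : RWreath A B) :
    V.CSeparable (kcl w (wrSub B L)) := by
  have := V.finite B hB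
  obtain ⟨hLn, hLm⟩ := id hL
  rw [sep_iff]
  intro v hv
  by_cases h1 : v.right = w.right
  swap
  · refine ⟨(SemidirectProduct.rightHom).ker, ker_mem _ hB, ?_⟩
    rintro _ ⟨k, hk, rfl⟩ hc
    rw [MonoidHom.mem_ker] at hc
    simp only [SemidirectProduct.rightHom_eq_right, map_mul, map_inv, hk.1] at hc
    simp [inv_mul_eq_one] at hc
    exact h1 hc
  -- relation mod a subgroup
  have hmod : ∀ (N : Subgroup A) [N.Normal] (u : RWreath A B), v⁻¹ * u ∈ wrSub B N →
      ∀ x, ((v.left : B → A) x)⁻¹ * (u.left : B → A) x ∈ N := by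
    intro N _ u hu x
    have := hu.2 (v.right⁻¹ * x)
    rw [SemidirectProduct.mul_left, SemidirectProduct.inv_left] at this
    have e : ((v.left : B → A) ((v.right⁻¹)⁻¹ * (v.right⁻¹ * x)))⁻¹ *
      (u.left : B → A) ((v.right⁻¹)⁻¹ * (v.right⁻¹ * x)) ∈ N := this
    simpa using e
  have hcl : ∀ k ∈ wrSub B L, ∀ x, (k.left : B → A) x * (w.left : B → A) x *
      ((k.left : B → A) (w.right⁻¹ * x))⁻¹ = ((k * w * k⁻¹).left : B → A) x := by
    intro k hk x
    rw [conj_left, hk.1]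
    simp
  by_cases h2 : ∀ x, ((w.left : B → A) x)⁻¹ * (v.left : B → A) x ∈ L
  swap
  · refine ⟨wrSub B L, wrSub_mem hB hL, ?_⟩
    rintro _ ⟨k, hk, rfl⟩ hc
    apply h2
    intro x
    have h3 := hmod L _ hc x
    rw [← hcl k hk] at h3
    rw [← QuotientGroup.eq] at h3 ⊢
    rw [h3]
    simp only [QuotientGroup.mk_mul, QuotientGroup.mk_inv, (QuotientGroup.eq_one_iff _).2 (hk.2 _)]
    simp
  by_cases h3 : ∀ x, wrP v.left w.right x (orderOf w.right) ∈
      kcl (wrP w.left w.right x (orderOf w.right)) L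
  · exfalso
    obtain ⟨k, hkL, hk⟩ := exists_solution L h2 h3
    apply hv
    refine ⟨SemidirectProduct.inl ⟨k, Set.toFinite _⟩, ⟨rfl, hkL⟩, ?_⟩
    apply SemidirectProduct.ext
    · ext x
      rw [← hcl _ ⟨rfl, hkL⟩]
      exact hk x
    · simp [h1]
  · push Not at h3
    obtain ⟨x, hx⟩ := h3
    obtain ⟨N, hN, hNx⟩ := sep_iff.1 (hA _) _ hx
    obtain ⟨hNn, hNm⟩ := id hN
    refine ⟨wrSub B N, wrSub_mem hB hN, ?_⟩
    rintro _ ⟨k, hk, rfl⟩ hc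
    refine hNx (wrP (k * w * k⁻¹).left w.right x (orderOf w.right)) ?_ ?_
    · refine ⟨(k.left : B → A) x, hk.2 x, ?_⟩
      rw [wrP_conj (hcl k hk), pow_orderOf_eq_one, one_mul]
    · rw [← QuotientGroup.eq]
      exact wrP_mod N (hmod N _ hc) x _

end WreathProof

/-- If `B ∈ 𝒞`, then `A ≀ B` is `𝒞`-hereditarily conjugacy separable
iff `A` is `𝒞`-hereditarily conjugacy separable. -/
theorem wreath_CHCS_iff_of_acting_in_C (V : ECPseudoVariety.{u}) (A B : Type u)
    [Group A] [Group B] (hB : V.mem B) :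
    V.HCS (RWreath A B) ↔ V.HCS A := by
  have := V.finite B hB
  rw [ECPseudoVariety.hcs_iff ⟨_, ECPseudoVariety.ker_mem (1 : RWreath A B →* B) hB⟩,
    ECPseudoVariety.hcs_iff ⟨_, ECPseudoVariety.ker_mem (1 : A →* B) hB⟩]
  constructor
  · intro h L hL a
    have h1 := ECPseudoVariety.sep_preimage (wrDiag : A →* RWreath A B)
      (h _ (wrSub_mem hB hL) (wrDiag a))
    convert h1 using 1
    ext y
    constructor
    · rintro ⟨k, hk, rfl⟩
      refine ⟨wrDiag k, ⟨rfl, fun _ => hk⟩, ?_⟩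
      simp
    · rintro ⟨k, hk, he⟩
      have h2 := congrArg (fun w : RWreath A B => (w.left : B → A) 1) he
      simp only [conj_left] at h2
      refine ⟨(k.left : B → A) 1, hk.2 1, ?_⟩
      rw [hk.1] at h2
      have h3 : (k.left : B → A) 1 * a *
          ((k.left : B → A) ((1 : B) * (1 : B)⁻¹ * (1 : B)⁻¹ * 1))⁻¹ = y := h2
      simpa using h3
  · intro h K hK w
    obtain ⟨L, hL, hLK⟩ := wrSub_cofinal hB hK
    exact ECPseudoVariety.kcl_sep_of_le (wrSub_mem hB hL) hLK
      (kcl_wrSub_sep hB hL (h L hL)) w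
end
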